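/- arXiv:1808.02675 — 5 statements merged into one kernel-verified Lean document; each statement's English description precedes it below -/
import Mathlib

section
/- Let ℓ ≥ 3 and r ≥ 3 be integers. If the generalised H-graph H^ℓ(r) admits a packing 5-colouring, then it admits a packing 5-colouring π such that for every i with 1 ≤ i ≤ ℓ and every j with 0 ≤ j ≤ r−1, at least one of the endpoints of the edge u^i_{2j}u^i_{2j+1} receives colour 1. -/
/-- A packing `k`-colouring of a simple graph `G`: every vertex gets a colour in
`{1, …, k}` and any two distinct vertices sharing a colour `i` are at distance
greater than `i` in `G` (i.e. every walk joining them has length greater than `i`). -/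
def IsPackingColoring {V : Type*} (G : SimpleGraph V) (k : ℕ) (π : V → ℕ) : Prop :=
  (∀ v, 1 ≤ π v ∧ π v ≤ k) ∧
    ∀ u v : V, u ≠ v → π u = π v → ∀ p : G.Walk u v, π u < p.length

/-- The packing chromatic number of `G`: the least `k` admitting a packing `k`-colouring. -/
noncomputable def packingChromaticNumber {V : Type*} (G : SimpleGraph V) : ℕ :=
  sInf {k | ∃ π : V → ℕ, IsPackingColoring G k π}

/-- The generalised H-graph `H^ℓ(r)` with `ℓ` levels: vertices `uⁱⱼ = (i, j)` for
`i : Fin (ℓ+2)` and `j : ZMod (2*r)`; the outer cycles are on levels `0` and `ℓ+1`,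
level `i` (`1 ≤ i ≤ ℓ`) carries the matching edges `uⁱ₂ⱼuⁱ₂ⱼ₊₁` (`0 ≤ j ≤ r-1`),
and `uⁱⱼ` is joined to `uⁱ⁺¹ⱼ` for `0 ≤ i ≤ ℓ`. -/
def genHgraph (ℓ r : ℕ) : SimpleGraph (Fin (ℓ + 2) × ZMod (2 * r)) :=
  SimpleGraph.fromRel (fun x y =>
    (∃ j : ZMod (2 * r), x = ((0 : Fin (ℓ + 2)), j) ∧ y = ((0 : Fin (ℓ + 2)), j + 1)) ∨
    (∃ j : ZMod (2 * r), x = (Fin.last (ℓ + 1), j) ∧ y = (Fin.last (ℓ + 1), j + 1)) ∨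
    (∃ i : Fin (ℓ + 2), ∃ j : ℕ, 1 ≤ (i : ℕ) ∧ (i : ℕ) ≤ ℓ ∧ j < r ∧
      x = (i, ((2 * j : ℕ) : ZMod (2 * r))) ∧ y = (i, ((2 * j + 1 : ℕ) : ZMod (2 * r)))) ∨
    (∃ i : Fin (ℓ + 2), ∃ j : ZMod (2 * r), (i : ℕ) ≤ ℓ ∧ x = (i, j) ∧ y = (i + 1, j)))

namespace IsPackingColoring

variable {V : Type*} {G : SimpleGraph V} {k : ℕ} {π : V → ℕ}

lemma ne_of_adj (h : IsPackingColoring G k π) {u v : V} (huv : G.Adj u v) : π u ≠ π v := by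
  intro he
  have h1 := h.2 u v huv.ne he huv.toWalk
  have h2 := (h.1 u).1
  simp at h1
  omega

lemma lt_two (h : IsPackingColoring G k π) {u v w : V} (hne : u ≠ w) (h₁ : G.Adj u v)
    (h₂ : G.Adj v w) : π u = π w → π u < 2 := fun he ↦ by
  simpa using h.2 u w hne he (.cons h₁ h₂.toWalk)

lemma lt_three (h : IsPackingColoring G k π) {u v w x : V} (hne : u ≠ x) (h₁ : G.Adj u v)
    (h₂ : G.Adj v w) (h₃ : G.Adj w x) : π u = π x → π u < 3 := fun he ↦ by
  simpa using h.2 u x hne he (.cons h₁ (.cons h₂ h₃.toWalk))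

lemma lt_four (h : IsPackingColoring G k π) {u v w x y : V} (hne : u ≠ y) (h₁ : G.Adj u v)
    (h₂ : G.Adj v w) (h₃ : G.Adj w x) (h₄ : G.Adj x y) : π u = π y → π u < 4 := fun he ↦ by
  simpa using h.2 u y hne he (.cons h₁ (.cons h₂ (.cons h₃ h₄.toWalk)))

lemma lt_five (h : IsPackingColoring G k π) {u v w x y z : V} (hne : u ≠ z) (h₁ : G.Adj u v)
    (h₂ : G.Adj v w) (h₃ : G.Adj w x) (h₄ : G.Adj x y) (h₅ : G.Adj y z) :
    π u = π z → π u < 5 := fun he ↦ by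
  simpa using h.2 u z hne he (.cons h₁ (.cons h₂ (.cons h₃ (.cons h₄ h₅.toWalk))))

/-- Recolouring with `1` a vertex without neighbours of colour `1` keeps a packing colouring. -/
lemma update_one [DecidableEq V] (h : IsPackingColoring G k π) {v : V}
    (hv : ∀ w, G.Adj v w → π w ≠ 1) : IsPackingColoring G k (Function.update π v 1) := by
  have one_lt : ∀ u w : V, u ≠ w → ¬ G.Adj u w → ∀ p : G.Walk u w, 1 < p.length := by
    intro u w huw hadj p
    by_contra! hp
    rcases Nat.le_one_iff_eq_zero_or_eq_one.mp hp with h0 | h1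
    · exact huw (SimpleGraph.Walk.eq_of_length_eq_zero h0)
    · exact hadj (SimpleGraph.Walk.adj_of_length_eq_one h1)
  refine ⟨fun u ↦ ?_, fun u w huw he p ↦ ?_⟩
  · have h1 := h.1 u
    have h2 := h.1 v
    by_cases huv : u = v
    · subst huv
      simp only [Function.update_self]
      omega
    · simpa [huv] using h1
  · by_cases huv : u = v
    · subst huv
      simp only [Function.update_self, Function.update_of_ne huw.symm] at he ⊢
      exact one_lt u w huw (fun ha ↦ hv w ha he.symm) p
    · by_cases hwv : w = v
      · subst hwv
        simp only [Function.update_self, Function.update_of_ne huw] at he ⊢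
        rw [he]
        exact one_lt u w huw (fun ha ↦ hv u ha.symm he) p
      · simp only [Function.update_of_ne huv, Function.update_of_ne hwv] at he ⊢
        exact h.2 u w huw he p

/-- A packing colouring of a finite graph can be chosen so that the colour `1` is dominating. -/
lemma exists_one_dominating [Finite V] (h : IsPackingColoring G k π) :
    ∃ π' : V → ℕ, IsPackingColoring G k π' ∧ ∀ v, π' v ≠ 1 → ∃ w, G.Adj v w ∧ π' w = 1 := by
  classical
  obtain ⟨π', hπ', hmin⟩ := (measure fun c : V → ℕ ↦ {v | c v ≠ 1}.ncard).wf.has_min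
    {c | IsPackingColoring G k c} ⟨π, h⟩
  refine ⟨π', hπ', fun v hv ↦ ?_⟩
  by_contra! hw
  refine hmin _ (hπ'.update_one hw) (Set.ncard_lt_ncard ?_ (Set.toFinite _))
  refine ⟨fun u hu ↦ ?_, fun hsub ↦ ?_⟩
  · by_cases huv : u = v
    · subst huv
      exact hv
    · simpa [huv] using hu
  · simpa using hsub (show v ∈ {v | π' v ≠ 1} from hv)

/-- The colours around an edge `ab` avoiding colour `1`, when the `1`-coloured neighbours `p` of
`a` and `q` of `b` lie on opposite sides: `c a b d` is a path, `p` is adjacent to `a, d, e` and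
`q` is adjacent to `b, c, h`. -/
lemma colours_around_edge (hπ : IsPackingColoring G 5 π) {a b c d e h p q : V}
    (hca : G.Adj c a) (hab : G.Adj a b) (hbd : G.Adj b d) (hap : G.Adj a p) (hpd : G.Adj p d)
    (hpe : G.Adj p e) (hbq : G.Adj b q) (hqc : G.Adj q c) (hqh : G.Adj q h)
    (hcb : c ≠ b) (had : a ≠ d) (hcd : c ≠ d) (hea : e ≠ a) (hed : e ≠ d) (heb : e ≠ b)
    (hec : e ≠ c) (hhb : h ≠ b) (hhc : h ≠ c) (hha : h ≠ a) (hhd : h ≠ d) (heh : e ≠ h)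
    (ha : π a ≠ 1) (hb : π b ≠ 1) (hp : π p = 1) (hq : π q = 1) :
    π d = 2 ∧ π c = 2 ∧ π a ≠ 2 ∧ π b ≠ 2 ∧ π e = π h ∧ 3 ≤ π e ∧ π e ≤ 4 ∧ π e ≠ π a ∧
      π e ≠ π b ∧ π a ≠ π b := by
  have two_le {v : V} (hv : π v ≠ 1) : 2 ≤ π v := by
    have := (hπ.1 v).1
    omega
  have ha2 := two_le ha
  have hb2 := two_le hb
  have hc2 := two_le fun hc ↦ hπ.ne_of_adj hqc (hq.trans hc.symm)
  have hd2 := two_le fun hd ↦ hπ.ne_of_adj hpd (hp.trans hd.symm)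
  have he2 := two_le fun he ↦ hπ.ne_of_adj hpe (hp.trans he.symm)
  have hh2 := two_le fun hh ↦ hπ.ne_of_adj hqh (hq.trans hh.symm)
  have ha5 := (hπ.1 a).2
  have hb5 := (hπ.1 b).2
  have hc5 := (hπ.1 c).2
  have hd5 := (hπ.1 d).2
  have he5 := (hπ.1 e).2
  have hh5 := (hπ.1 h).2
  have dca := hπ.ne_of_adj hca
  have dab := hπ.ne_of_adj hab
  have dbd := hπ.ne_of_adj hbd
  have dcb : π c ≠ π b := fun h ↦ (hπ.lt_two hcb hca hab h).not_ge hc2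
  have dad : π a ≠ π d := fun h ↦ (hπ.lt_two had hab hbd h).not_ge ha2
  have dea : π e ≠ π a := fun h ↦ (hπ.lt_two hea hpe.symm hap.symm h).not_ge he2
  have ded : π e ≠ π d := fun h ↦ (hπ.lt_two hed hpe.symm hpd h).not_ge he2
  have dhb : π h ≠ π b := fun h' ↦ (hπ.lt_two hhb hqh.symm hbq.symm h').not_ge hh2
  have dhc : π h ≠ π c := fun h' ↦ (hπ.lt_two hhc hqh.symm hqc h').not_ge hh2
  have dcd := hπ.lt_three hcd hca hab hbd
  have deb := hπ.lt_three heb hpe.symm hap.symm hab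
  have dec := hπ.lt_three hec hpe.symm hap.symm hca.symm
  have dha := hπ.lt_three hha hqh.symm hbq.symm hab.symm
  have dhd := hπ.lt_three hhd hqh.symm hbq.symm hbd
  have deh := hπ.lt_five heh hpe.symm hap.symm hab hbq hqh
  have hcd' : π c = π d := by
    by_contra hcd'
    have hsub : ({π a, π b, π c, π d} : Finset ℕ) = Finset.Icc 2 5 := by
      refine Finset.eq_of_subset_of_card_le (fun x hx ↦ ?_) ?_
      · simp only [Finset.mem_insert, Finset.mem_singleton] at hx
        rw [Finset.mem_Icc]
        rcases hx with rfl | rfl | rfl | rfl <;> constructor <;> assumption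
      · simp [Finset.card_insert_of_notMem, dab, dca.symm, dad, dcb.symm, dbd, hcd']
    have hmem : ∀ x, 2 ≤ x → x ≤ 5 → x = π a ∨ x = π b ∨ x = π c ∨ x = π d := by
      intro x h2 h5
      have : x ∈ ({π a, π b, π c, π d} : Finset ℕ) := hsub ▸ Finset.mem_Icc.2 ⟨h2, h5⟩
      simpa using this
    have he3 : π e < 3 := by
      rcases hmem (π e) he2 he5 with h | h | h | h
      exacts [absurd h dea, deb h, dec h, absurd h ded]
    have hh3 : π h < 3 := by
      rcases hmem (π h) hh2 hh5 with h | h | h | h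
      exacts [dha h, absurd h dhb, absurd h dhc, dhd h]
    rcases hmem 2 le_rfl (by norm_num) with h | h | h | h <;> omega
  have hc3 := dcd hcd'
  have heb' : π e ≠ π b := fun h ↦ by
    have := deb h
    omega
  have hha' : π h ≠ π a := fun h ↦ by
    have := dha h
    omega
  have heh' : π e = π h := by
    clear dec dhd deb dha dcd deh
    omega
  have := deh heh'
  clear dec dhd deb dha dcd deh
  omega

/-- If the ladder continues past `d, e` with a common neighbour `f`, then `a` has colour `3`. -/
lemma eq_three_of_common_neighbour (hπ : IsPackingColoring G 5 π) {a b d e f y : V}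
    (hab : G.Adj a b) (hbd : G.Adj b d) (hdf : G.Adj d f) (hef : G.Adj e f) (hfy : G.Adj f y)
    (hfb : f ≠ b) (hfa : f ≠ a) (hyd : y ≠ d) (hye : y ≠ e) (hyb : y ≠ b) (hya : y ≠ a)
    (hd : π d = 2) (ha : 3 ≤ π a) (hb : 3 ≤ π b) (he : 3 ≤ π e)
    (hea : π e ≠ π a) (heb : π e ≠ π b) (hab' : π a ≠ π b) : π a = 3 := by
  have := hπ.1 a
  have := hπ.1 b
  have := hπ.1 e
  have := hπ.1 f
  have := hπ.1 y
  have := hπ.ne_of_adj hdf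
  have := hπ.ne_of_adj hef
  have := hπ.ne_of_adj hfy
  have := hπ.lt_two hfb hdf.symm hbd.symm
  have := hπ.lt_three hfa hdf.symm hbd.symm hab.symm
  have := hπ.lt_two hyd hfy.symm hdf.symm
  have := hπ.lt_two hye hfy.symm hef.symm
  have := hπ.lt_three hyb hfy.symm hdf.symm hbd.symm
  have := hπ.lt_four hya hfy.symm hdf.symm hbd.symm hab.symm
  omega

/-- A path `d z w` cannot leave the configuration of `colours_around_edge` when `b` has
colour `3`. -/
lemma false_of_path (hπ : IsPackingColoring G 5 π) {a b d e p z w : V}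
    (hab : G.Adj a b) (hbd : G.Adj b d) (hpd : G.Adj p d) (hpe : G.Adj p e)
    (hdz : G.Adj d z) (hzw : G.Adj z w)
    (hzb : z ≠ b) (hza : z ≠ a) (hze : z ≠ e) (hwd : w ≠ d) (hwb : w ≠ b) (hwa : w ≠ a)
    (hwe : w ≠ e)
    (hd : π d = 2) (ha : 3 ≤ π a) (hb : π b = 3) (he : π e = 4) (hea : π e ≠ π a)
    (hab' : π a ≠ π b) : False := by
  have := hπ.1 a
  have := hπ.1 z
  have := hπ.1 w
  have := hπ.ne_of_adj hdz
  have := hπ.ne_of_adj hzw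
  have := hπ.lt_two hzb hdz.symm hbd.symm
  have := hπ.lt_three hza hdz.symm hbd.symm hab.symm
  have := hπ.lt_three hze hdz.symm hpd.symm hpe
  have := hπ.lt_two hwd hzw.symm hdz.symm
  have := hπ.lt_three hwb hzw.symm hdz.symm hbd.symm
  have := hπ.lt_four hwa hzw.symm hdz.symm hbd.symm hab.symm
  have := hπ.lt_four hwe hzw.symm hdz.symm hpd.symm hpe
  omega

end IsPackingColoring

/-- Local coordinates `(level, column)` on a graph around a ladder occupying columns `0` and `1`,
with horizontal paths along the extreme levels `0` and `ℓ + 1`. -/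
structure LadderFrame {V : Type*} (G : SimpleGraph V) (ℓ : ℕ) (φ : ℕ → ℤ → V) : Prop where
  vert : ∀ i k, i ≤ ℓ → G.Adj (φ i k) (φ (i + 1) k)
  bot : ∀ k, G.Adj (φ 0 k) (φ 0 (k + 1))
  top : ∀ k, G.Adj (φ (ℓ + 1) k) (φ (ℓ + 1) (k + 1))
  rung : ∀ i, i ≤ ℓ + 1 → G.Adj (φ i 0) (φ i 1)
  ne : ∀ i i' k k', i ≤ ℓ + 1 → i' ≤ ℓ + 1 → |k - k'| < 6 → (i ≠ i' ∨ k ≠ k') → φ i k ≠ φ i' k'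
  nbr_left : ∀ i w, i < ℓ → G.Adj (φ (i + 1) 0) w →
    w = φ i 0 ∨ w = φ (i + 2) 0 ∨ w = φ (i + 1) 1
  nbr_right : ∀ i w, i < ℓ → G.Adj (φ (i + 1) 1) w →
    w = φ i 1 ∨ w = φ (i + 2) 1 ∨ w = φ (i + 1) 0

namespace LadderFrame

variable {V : Type*} {G : SimpleGraph V} {ℓ : ℕ} {φ : ℕ → ℤ → V} {π : V → ℕ}

lemma flipColumns (F : LadderFrame G ℓ φ) : LadderFrame G ℓ (fun i k ↦ φ i (1 - k)) where
  vert i k hi := F.vert i _ hi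
  bot k := by
    have := (F.bot (1 - (k + 1))).symm
    rwa [show 1 - (k + 1) + 1 = 1 - k by ring] at this
  top k := by
    have := (F.top (1 - (k + 1))).symm
    rwa [show 1 - (k + 1) + 1 = 1 - k by ring] at this
  rung i hi := by simpa using (F.rung i hi).symm
  ne i i' k k' hi hi' hk h := F.ne _ _ _ _ hi hi' (by rw [abs_lt] at *; omega) (by omega)
  nbr_left i w hi h := by simpa using F.nbr_right i w hi (by simpa using h)
  nbr_right i w hi h := by simpa using F.nbr_left i w hi (by simpa using h)

lemma flipLevels (F : LadderFrame G ℓ φ) : LadderFrame G ℓ (fun i k ↦ φ (ℓ + 1 - i) k) where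
  vert i k hi := by
    have := (F.vert (ℓ + 1 - (i + 1)) k (by omega)).symm
    rwa [show ℓ + 1 - (i + 1) + 1 = ℓ + 1 - i by omega] at this
  bot k := F.top k
  top k := by simpa using F.bot k
  rung i _ := F.rung _ (by omega)
  ne i i' k k' hi hi' hk h := F.ne _ _ _ _ (by omega) (by omega) hk (by omega)
  nbr_left i w hi h := by
    have e1 : ℓ + 1 - (i + 1) = (ℓ - (i + 1)) + 1 := by omega
    have e2 : ℓ + 1 - i = (ℓ - (i + 1)) + 2 := by omega
    have e3 : ℓ + 1 - (i + 2) = ℓ - (i + 1) := by omega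
    rw [e1] at h
    rw [e1, e2, e3]
    have := F.nbr_left _ w (by omega) h
    tauto
  nbr_right i w hi h := by
    have e1 : ℓ + 1 - (i + 1) = (ℓ - (i + 1)) + 1 := by omega
    have e2 : ℓ + 1 - i = (ℓ - (i + 1)) + 2 := by omega
    have e3 : ℓ + 1 - (i + 2) = ℓ - (i + 1) := by omega
    rw [e1] at h
    rw [e1, e2, e3]
    have := F.nbr_right _ w (by omega) h
    tauto

/-- The configuration with the `1`-coloured neighbours of a rung on opposite sides is impossible,
when the rung is not on the level `1`. -/
lemma false_of_opposite (F : LadderFrame G ℓ φ) (hπ : IsPackingColoring G 5 π) {m : ℕ}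
    (hm : m + 2 ≤ ℓ) (ha : π (φ (m + 2) 0) ≠ 1) (hb : π (φ (m + 2) 1) ≠ 1)
    (hp : π (φ (m + 3) 0) = 1) (hq : π (φ (m + 1) 1) = 1) : False := by
  obtain ⟨e, hpe, hne_e, he_up⟩ : ∃ e, G.Adj (φ (m + 3) 0) e ∧
      (∀ i k, i ≤ m + 3 → 0 ≤ k → k ≤ 3 → e ≠ φ i k) ∧ (m + 2 < ℓ → e = φ (m + 4) 0) := by
    rcases hm.lt_or_eq with hlt | heq
    · exact ⟨φ (m + 4) 0, F.vert (m + 3) 0 (by omega),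
        fun i k hi h0 h3 ↦ F.ne _ _ _ _ (by omega) (by omega) (by rw [abs_lt]; omega) (by omega),
        fun _ ↦ rfl⟩
    · subst heq
      exact ⟨φ (m + 3) (-1), by simpa using (F.top (-1)).symm,
        fun i k hi h0 h3 ↦ F.ne _ _ _ _ (by omega) (by omega) (by rw [abs_lt]; omega) (by omega),
        fun h ↦ absurd h (lt_irrefl _)⟩
  obtain ⟨y, hgy, hne_y⟩ : ∃ y, G.Adj (φ m 0) y ∧
      ∀ i k, m ≤ i → i ≤ ℓ + 1 → 0 ≤ k → k ≤ 1 → y ≠ φ i k := by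
    rcases m with _ | m
    · exact ⟨φ 0 (-1), by simpa using (F.bot (-1)).symm,
        fun i k _ hi h0 h1 ↦ F.ne _ _ _ _ (by omega) (by omega) (by rw [abs_lt]; omega)
          (by omega)⟩
    · exact ⟨φ m 0, (F.vert m 0 (by omega)).symm,
        fun i k _ hi h0 h1 ↦ F.ne _ _ _ _ (by omega) (by omega) (by rw [abs_lt]; omega)
          (by omega)⟩
  have hca : G.Adj (φ (m + 1) 0) (φ (m + 2) 0) := F.vert (m + 1) 0 (by omega)
  have hab := F.rung (m + 2) (by omega)
  have hbd : G.Adj (φ (m + 2) 1) (φ (m + 3) 1) := F.vert (m + 2) 1 (by omega)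
  have hap : G.Adj (φ (m + 2) 0) (φ (m + 3) 0) := F.vert (m + 2) 0 (by omega)
  have hpd := F.rung (m + 3) (by omega)
  have hbq : G.Adj (φ (m + 2) 1) (φ (m + 1) 1) := (F.vert (m + 1) 1 (by omega)).symm
  have hqc := (F.rung (m + 1) (by omega)).symm
  have hqh := (F.vert m 1 (by omega)).symm
  have hne' : ∀ i i' k k', i ≤ m + 3 → i' ≤ m + 3 → 0 ≤ k → k ≤ 3 → 0 ≤ k' → k' ≤ 3 →
      (i ≠ i' ∨ k ≠ k') → φ i k ≠ φ i' k' := fun i i' k k' _ _ _ _ _ _ h ↦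
    F.ne _ _ _ _ (by omega) (by omega) (by rw [abs_lt]; omega) h
  obtain ⟨hd, hc, ha2, hb2, heh, he3, he4, hea, heb, hab'⟩ :=
    hπ.colours_around_edge hca hab hbd hap hpd hpe hbq hqc hqh
      (by apply hne' <;> omega) (by apply hne' <;> omega) (by apply hne' <;> omega)
      (by apply hne_e <;> omega) (by apply hne_e <;> omega) (by apply hne_e <;> omega)
      (by apply hne_e <;> omega) (by apply hne' <;> omega) (by apply hne' <;> omega)
      (by apply hne' <;> omega) (by apply hne' <;> omega) (by apply hne_e <;> omega)
      ha hb hp hq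
  have ha1 := hπ.1 (φ (m + 2) 0)
  have hb1 := hπ.1 (φ (m + 2) 1)
  have hb3 : π (φ (m + 2) 1) = 3 :=
    hπ.eq_three_of_common_neighbour hab.symm hca.symm (F.vert m 0 (by omega)).symm
      (F.rung m (by omega)).symm hgy
      (by apply hne' <;> omega) (by apply hne' <;> omega) (by apply hne_y <;> omega)
      (by apply hne_y <;> omega) (by apply hne_y <;> omega) (by apply hne_y <;> omega)
      hc (by omega) (by omega) (by omega) (by omega) (by omega) hab'.symm
  rcases hm.lt_or_eq with hlt | heq
  · obtain rfl := he_up hlt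
    obtain ⟨y, hfy, hne_y⟩ : ∃ y, G.Adj (φ (m + 4) 1) y ∧
        ∀ i k, i ≤ m + 4 → 0 ≤ k → k ≤ 1 → y ≠ φ i k := by
      rcases (show m + 3 ≤ ℓ from hlt).lt_or_eq with hlt' | heq
      · exact ⟨φ (m + 5) 1, F.vert _ _ (by omega), fun i k _ h0 h1 ↦
          F.ne _ _ _ _ (by omega) (by omega) (by rw [abs_lt]; omega) (by omega)⟩
      · subst heq
        exact ⟨φ (m + 4) 2, F.top 1, fun i k _ h0 h1 ↦
          F.ne _ _ _ _ (by omega) (by omega) (by rw [abs_lt]; omega) (by omega)⟩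
    have ha3 : π (φ (m + 2) 0) = 3 :=
      hπ.eq_three_of_common_neighbour hab hbd (F.vert (m + 3) 1 (by omega))
        (F.rung (m + 4) (by omega)) hfy
        (by apply F.ne <;> simp <;> omega) (by apply F.ne <;> simp <;> omega)
        (by apply hne_y <;> omega) (by apply hne_y <;> omega) (by apply hne_y <;> omega)
        (by apply hne_y <;> omega)
        hd (by omega) (by omega) he3 hea heb hab'
    omega
  · subst heq
    exact hπ.false_of_path hab hbd hpd hpe (F.top 1) (F.top (1 + 1))
      (by apply hne' <;> omega) (by apply hne' <;> omega)
      (by apply Ne.symm; apply hne_e <;> omega)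
      (by apply hne' <;> omega) (by apply hne' <;> omega) (by apply hne' <;> omega)
      (by apply Ne.symm; apply hne_e <;> omega)
      hd (by omega) hb3 (by omega) hea hab'

/-- If the colour `1` is dominating, every inner rung of the ladder meets it. -/
lemma one_mem_rung (F : LadderFrame G ℓ φ) (hℓ : 2 ≤ ℓ) (hπ : IsPackingColoring G 5 π)
    (hdom : ∀ v, π v ≠ 1 → ∃ w, G.Adj v w ∧ π w = 1) {i : ℕ} (hi : i < ℓ) :
    π (φ (i + 1) 0) = 1 ∨ π (φ (i + 1) 1) = 1 := by
  have opposite : ∀ φ : ℕ → ℤ → V, LadderFrame G ℓ φ → ∀ i < ℓ, π (φ (i + 1) 0) ≠ 1 →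
      π (φ (i + 1) 1) ≠ 1 → π (φ (i + 2) 0) = 1 → π (φ i 1) = 1 → False := by
    intro φ F i hi ha hb hp hq
    rcases i with _ | m
    · obtain ⟨n, rfl⟩ : ∃ n, ℓ = n + 2 := ⟨ℓ - 2, by omega⟩
      exact F.flipLevels.flipColumns.false_of_opposite hπ (m := n) le_rfl (by simpa using hb)
        (by simpa using ha) (by simpa using hq) (by simpa using hp)
    · exact F.false_of_opposite hπ (by omega) ha hb hp hq
  by_contra! h
  obtain ⟨ha, hb⟩ := h
  have hup := hπ.ne_of_adj (F.rung (i + 2) (by omega))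
  have hdown := hπ.ne_of_adj (F.rung i (by omega))
  obtain ⟨v, hav, hv⟩ := hdom _ ha
  obtain ⟨w, hbw, hw⟩ := hdom _ hb
  rcases F.nbr_left i v hi hav with rfl | rfl | rfl <;>
    rcases F.nbr_right i w hi hbw with rfl | rfl | rfl <;>
    first
    | contradiction
    | exact hup (by omega)
    | exact hdown (by omega)
    | exact opposite φ F i hi ha hb hv hw
    | exact opposite _ F.flipColumns i hi (by simpa using hb) (by simpa using ha)
        (by simpa using hw) (by simpa using hv)

end LadderFrame

lemma genHgraph_ladderFrame {ℓ r : ℕ} (hr : 3 ≤ r) {j : ℕ} (hj : j < r) :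
    LadderFrame (genHgraph ℓ r) ℓ
      (fun i k ↦ (Fin.ofNat (ℓ + 2) i, ((2 * j : ℕ) : ZMod (2 * r)) + (k : ZMod (2 * r)))) := by
  have hcast : ∀ k k' : ℤ, |k - k'| < 6 → (k : ZMod (2 * r)) = k' → k = k' := by
    intro k k' hk h
    rw [ZMod.intCast_eq_intCast_iff_dvd_sub] at h
    have := Int.eq_zero_of_abs_lt_dvd h (by rw [abs_sub_comm]; push_cast; omega)
    omega
  have hone : (1 : ZMod (2 * r)) ≠ 0 := fun h ↦ by
    have := hcast 1 0 (by norm_num) (by simpa using h)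
    omega
  have hval : ∀ i, i ≤ ℓ + 1 → (Fin.ofNat (ℓ + 2) i : ℕ) = i := fun i hi ↦ by
    simp [Fin.ofNat, Nat.mod_eq_of_lt (show i < ℓ + 2 by omega)]
  have hsucc : ∀ i, (Fin.ofNat (ℓ + 2) (i + 1)) = Fin.ofNat (ℓ + 2) i + 1 := fun i ↦ by
    ext; simp [Fin.ofNat, Fin.val_add]
  have hlast : Fin.ofNat (ℓ + 2) (ℓ + 1) = Fin.last (ℓ + 1) := by
    ext; simp [Fin.ofNat]
  have hzero : Fin.ofNat (ℓ + 2) 0 = 0 := rfl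
  have hnat : ∀ a b : ℕ, a < 2 * r → b < 2 * r → (a : ZMod (2 * r)) = b → a = b := by
    intro a b ha hb h
    rw [ZMod.natCast_eq_natCast_iff'] at h
    rwa [Nat.mod_eq_of_lt ha, Nat.mod_eq_of_lt hb] at h
  have hinner : ∀ i, i < ℓ → Fin.ofNat (ℓ + 2) (i + 1) ≠ 0 ∧
      Fin.ofNat (ℓ + 2) (i + 1) ≠ Fin.last (ℓ + 1) := by
    intro i hi
    rw [← hlast, ← hzero, ne_eq, ne_eq, Fin.ext_iff, Fin.ext_iff, hval _ (by omega),
      hval _ (by omega), hval _ (by omega)]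
    omega
  refine ⟨fun i k hi ↦ ?_, fun k ↦ ?_, fun k ↦ ?_, fun i hi ↦ ?_, fun i i' k k' hi hi' hk h he ↦ ?_,
    fun i w hi hw ↦ ?_, fun i w hi hw ↦ ?_⟩
  · refine (SimpleGraph.fromRel_adj _ _ _).2 ⟨fun h ↦ ?_, .inl <| .inr <| .inr <| .inr
      ⟨_, _, ?_, rfl, by rw [hsucc]⟩⟩
    · have := congrArg (fun x ↦ (x.1 : ℕ)) h
      simp only [hval i (by omega), hval (i + 1) (by omega)] at this
      omega
    · rwa [hval i (by omega)]
  · refine (SimpleGraph.fromRel_adj _ _ _).2 ⟨fun h ↦ ?_, .inl <| .inl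
      ⟨_, rfl, by push_cast; rw [add_assoc]; rfl⟩⟩
    simp [hone] at h
  · refine (SimpleGraph.fromRel_adj _ _ _).2 ⟨fun h ↦ ?_, .inl <| .inr <| .inl
      ⟨_, by rw [hlast], by rw [hlast]; push_cast; simp only [add_assoc]⟩⟩
    simp [hone] at h
  · refine (SimpleGraph.fromRel_adj _ _ _).2 ⟨fun h ↦ ?_, .inl ?_⟩
    · exact hone (by simpa using h.symm)
    · rcases i with _ | i
      · exact .inl ⟨(2 * j : ℕ), by simp, by simp⟩
      · rcases (show i ≤ ℓ by omega).lt_or_eq with hlt | rfl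
        · exact .inr <| .inr <| .inl ⟨Fin.ofNat (ℓ + 2) (i + 1), j, by rw [hval _ hi]; omega,
            by rw [hval _ hi]; omega, hj, by simp, by simp⟩
        · exact .inr <| .inl ⟨(2 * j : ℕ), by simp, by simp⟩
  · obtain ⟨h1, h2⟩ := Prod.ext_iff.1 he
    have h3 := hcast k k' hk (add_left_cancel h2)
    have h4 := congrArg Fin.val h1
    simp only [hval i hi, hval i' hi'] at h4
    omega
  · obtain ⟨hn0, hnl⟩ := hinner i hi
    obtain ⟨-, h | h⟩ := (SimpleGraph.fromRel_adj _ _ _).1 hw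
    · rcases h with ⟨m, h1, h2⟩ | ⟨m, h1, h2⟩ | ⟨i', m, _, _, hm, h1, h2⟩ | ⟨i', m, _, h1, h2⟩
      · exact absurd (congrArg Prod.fst h1) hn0
      · exact absurd (congrArg Prod.fst h1) hnl
      · obtain ⟨rfl, h3⟩ := Prod.ext_iff.1 h1
        have := hnat (2 * j) (2 * m) (by omega) (by omega) (by simpa using h3)
        obtain rfl : j = m := by omega
        exact .inr <| .inr <| by simp [h2]
      · obtain ⟨rfl, rfl⟩ := Prod.ext_iff.1 h1
        exact .inr <| .inl <| by rw [h2, ← hsucc]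
    · rcases h with ⟨m, h1, h2⟩ | ⟨m, h1, h2⟩ | ⟨i', m, _, _, hm, h1, h2⟩ | ⟨i', m, _, h1, h2⟩
      · exact absurd (congrArg Prod.fst h2) hn0
      · exact absurd (congrArg Prod.fst h2) hnl
      · obtain ⟨rfl, h3⟩ := Prod.ext_iff.1 h2
        have := hnat (2 * j) (2 * m + 1) (by omega) (by omega) (by simpa using h3)
        omega
      · obtain ⟨h3, rfl⟩ := Prod.ext_iff.1 h2
        rw [hsucc] at h3
        exact .inl <| by rw [h1, add_right_cancel h3]
  · obtain ⟨hn0, hnl⟩ := hinner i hi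
    obtain ⟨-, h | h⟩ := (SimpleGraph.fromRel_adj _ _ _).1 hw
    · rcases h with ⟨m, h1, h2⟩ | ⟨m, h1, h2⟩ | ⟨i', m, _, _, hm, h1, h2⟩ | ⟨i', m, _, h1, h2⟩
      · exact absurd (congrArg Prod.fst h1) hn0
      · exact absurd (congrArg Prod.fst h1) hnl
      · obtain ⟨rfl, h3⟩ := Prod.ext_iff.1 h1
        have := hnat (2 * j + 1) (2 * m) (by omega) (by omega) (by simpa using h3)
        omega
      · obtain ⟨rfl, rfl⟩ := Prod.ext_iff.1 h1
        exact .inr <| .inl <| by rw [h2, ← hsucc]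
    · rcases h with ⟨m, h1, h2⟩ | ⟨m, h1, h2⟩ | ⟨i', m, _, _, hm, h1, h2⟩ | ⟨i', m, _, h1, h2⟩
      · exact absurd (congrArg Prod.fst h2) hn0
      · exact absurd (congrArg Prod.fst h2) hnl
      · obtain ⟨rfl, h3⟩ := Prod.ext_iff.1 h2
        have := hnat (2 * j + 1) (2 * m + 1) (by omega) (by omega) (by simpa using h3)
        obtain rfl : j = m := by omega
        exact .inr <| .inr <| by simp [h1]
      · obtain ⟨h3, rfl⟩ := Prod.ext_iff.1 h2
        rw [hsucc] at h3
        exact .inl <| by rw [h1, add_right_cancel h3]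

theorem genHgraph_exists_colour_one_on_matching (ℓ r : ℕ) (hℓ : 3 ≤ ℓ) (hr : 3 ≤ r)
    (h : ∃ π : Fin (ℓ + 2) × ZMod (2 * r) → ℕ, IsPackingColoring (genHgraph ℓ r) 5 π) :
    ∃ π : Fin (ℓ + 2) × ZMod (2 * r) → ℕ, IsPackingColoring (genHgraph ℓ r) 5 π ∧
      ∀ i : Fin (ℓ + 2), 1 ≤ (i : ℕ) → (i : ℕ) ≤ ℓ → ∀ j : ℕ, j < r →
        π (i, ((2 * j : ℕ) : ZMod (2 * r))) = 1 ∨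
        π (i, ((2 * j + 1 : ℕ) : ZMod (2 * r))) = 1 := by
  have : NeZero (2 * r) := ⟨by omega⟩
  obtain ⟨π₀, hπ₀⟩ := h
  obtain ⟨π, hπ, hdom⟩ := hπ₀.exists_one_dominating
  refine ⟨π, hπ, fun i hi1 hiℓ j hj ↦ ?_⟩
  obtain ⟨n, hn⟩ : ∃ n, (i : ℕ) = n + 1 := ⟨i - 1, by omega⟩
  have := (genHgraph_ladderFrame hr hj).one_mem_rung (by omega) hπ hdom (i := n) (by omega)
  simpa [← hn] using this
end

section
/- Let ℓ ≥ 3 and r ≥ 3 be integers and let π be a packing 5-colouring of the generalised H-graph H^ℓ(r). Then for every j with 0 ≤ j ≤ 2r−1, at least one endpoint of the edge u^0_ju^0_{j+1} receives colour 1, and at least one endpoint of the edge u^{ℓ+1}_ju^{ℓ+1}_{j+1} receives colour 1 (subscripts taken modulo 2r). -/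
/-- The distance between two vertices (row, column) of the six-column window formed by three
consecutive ladders of a generalised H-graph, with rows counted from the outer cycle. -/
def windowDist (u v : Fin 4 × Fin 6) : ℕ :=
  (if u.2.val / 2 = v.2.val / 2 then (u.1.val - v.1.val) + (v.1.val - u.1.val)
    else u.1.val + v.1.val) + ((u.2.val - v.2.val) + (v.2.val - u.2.val))

theorem exists_windowDist_eq_one_of_ne : ∀ u v : Fin 4 × Fin 6, u ≠ v →
    ∃ w, windowDist u w = 1 ∧ windowDist u v = windowDist w v + 1 := by
  decide +kernel

theorem windowDist_eq_one_cases : ∀ u v : Fin 4 × Fin 6, windowDist u v = 1 →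
    (u.1 = v.1 ∧ (u.1 = 0 ∨ u.2.val % 2 = 0) ∧ v.2.val = u.2.val + 1) ∨
    (u.1 = v.1 ∧ (u.1 = 0 ∨ v.2.val % 2 = 0) ∧ u.2.val = v.2.val + 1) ∨
    (u.2 = v.2 ∧ v.1.val = u.1.val + 1) ∨ (u.2 = v.2 ∧ u.1.val = v.1.val + 1) := by
  decide +kernel

/-- Whether two coloured vertices of the window satisfy the packing condition. -/
def packingCompatible (a b : (Fin 4 × Fin 6) × ℕ) : Bool :=
  a.1 == b.1 || a.2 != b.2 || Nat.blt a.2 (windowDist a.1 b.1)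

/-- Exhaustive search certifying that the partial packing 5-colouring `A` of the window does not
extend to the vertices of the given list. -/
def noExtension (A : List ((Fin 4 × Fin 6) × ℕ)) : List (Fin 4 × Fin 6) → Bool
  | [] => false
  | v :: vs => [1, 2, 3, 4, 5].all fun k =>
      A.any (fun a => !packingCompatible a (v, k)) || noExtension ((v, k) :: A) vs

theorem noExtension_eq_false {c : Fin 4 × Fin 6 → ℕ} (hc : ∀ v, 1 ≤ c v ∧ c v ≤ 5)
    (hcomp : ∀ u v, packingCompatible (u, c u) (v, c v) = true) (vs : List (Fin 4 × Fin 6)) :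
    ∀ A : List ((Fin 4 × Fin 6) × ℕ), (∀ a ∈ A, a.2 = c a.1) → noExtension A vs = false := by
  induction vs with
  | nil => intro A _; rfl
  | cons v vs ih =>
    intro A hA
    have hmem : c v ∈ [1, 2, 3, 4, 5] := by
      have := hc v
      simp only [List.mem_cons, List.not_mem_nil, or_false]
      omega
    rw [noExtension, List.all_eq_false]
    refine ⟨c v, hmem, ?_⟩
    have hrec := ih ((v, c v) :: A) (by
      intro a ha
      rcases List.mem_cons.1 ha with rfl | ha
      · rfl
      · exact hA a ha)
    rw [hrec, Bool.or_false, Bool.not_eq_true, List.any_eq_false]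
    intro a ha
    obtain ⟨w, k⟩ := a
    obtain rfl : k = c w := hA _ ha
    simp [hcomp]

/-- Every vertex of the window apart from the two middle ones on the outer cycle. -/
def windowOrder : List (Fin 4 × Fin 6) :=
  [(1, 3), (1, 2), (2, 3), (2, 2), (3, 3), (3, 2), (0, 4), (0, 5), (1, 4), (0, 1), (0, 0), (1, 1),
    (1, 0), (2, 1), (1, 5), (2, 4), (2, 0), (2, 5), (3, 4), (3, 0), (3, 1), (3, 5)]

theorem noExtension_windowOrder : ([2, 3, 4, 5].all fun a => [2, 3, 4, 5].all fun b =>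
    noExtension [((0, 2), b), ((0, 3), a)] windowOrder ||
      !packingCompatible ((0, 2), b) ((0, 3), a)) = true := by
  decide +kernel

theorem window_middle_colour_one {c : Fin 4 × Fin 6 → ℕ} (hc : ∀ v, 1 ≤ c v ∧ c v ≤ 5)
    (hcomp : ∀ u v, packingCompatible (u, c u) (v, c v) = true) :
    c (0, 2) = 1 ∨ c (0, 3) = 1 := by
  by_contra! h
  have hmem : ∀ v, c v ≠ 1 → c v ∈ [2, 3, 4, 5] := by
    intro v hv
    have := hc v
    simp only [List.mem_cons, List.not_mem_nil, or_false]
    omega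
  have key := List.all_eq_true.1 (List.all_eq_true.1 noExtension_windowOrder _ (hmem _ h.2)) _
    (hmem _ h.1)
  rw [noExtension_eq_false hc hcomp _ _ (by simp), hcomp] at key
  simp at key

section Embedding

variable {V : Type*} {G : SimpleGraph V} {φ : Fin 4 × Fin 6 → V}

theorem exists_walk_length_eq_windowDist
    (hadj : ∀ u v, windowDist u v = 1 → G.Adj (φ u) (φ v)) (n : ℕ) :
    ∀ u v, windowDist u v = n → ∃ p : G.Walk (φ u) (φ v), p.length ≤ n := by
  induction n with
  | zero =>
    intro u v h
    by_cases huv : u = v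
    · subst huv
      exact ⟨.nil, le_rfl⟩
    · obtain ⟨w, -, hw⟩ := exists_windowDist_eq_one_of_ne u v huv
      omega
  | succ n ih =>
    intro u v h
    by_cases huv : u = v
    · subst huv
      exact ⟨.nil, Nat.zero_le _⟩
    · obtain ⟨w, hw, hwv⟩ := exists_windowDist_eq_one_of_ne u v huv
      obtain ⟨p, hp⟩ := ih w v (by omega)
      exact ⟨.cons (hadj u w hw) p, by simpa using hp⟩

theorem IsPackingColoring.window_middle_colour_one {π : V → ℕ} (hπ : IsPackingColoring G 5 π)
    (hφ : Function.Injective φ) (hadj : ∀ u v, windowDist u v = 1 → G.Adj (φ u) (φ v)) :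
    π (φ (0, 2)) = 1 ∨ π (φ (0, 3)) = 1 := by
  refine _root_.window_middle_colour_one (c := π ∘ φ) (fun v => hπ.1 _) fun u v => ?_
  by_cases huv : u = v
  · simp [packingCompatible, huv]
  by_cases hcol : π (φ u) = π (φ v)
  · obtain ⟨p, hp⟩ := exists_walk_length_eq_windowDist hadj _ u v rfl
    have := (hπ.2 _ _ (hφ.ne huv) hcol p).trans_le hp
    simp [packingCompatible, this]
  · simp [packingCompatible, hcol]

theorem IsPackingColoring.not_one_of_adj {k : ℕ} {π : V → ℕ} (hπ : IsPackingColoring G k π)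
    {u v : V} (h : G.Adj u v) : ¬(π u = 1 ∧ π v = 1) := by
  rintro ⟨hu, hv⟩
  have := hπ.2 u v h.ne (hu.trans hv.symm) h.toWalk
  simp [hu] at this

end Embedding

section GenHgraph

variable {ℓ r : ℕ}

theorem genHgraph_adj_first (hr : 3 ≤ r) (j : ZMod (2 * r)) :
    (genHgraph ℓ r).Adj (0, j) (0, j + 1) := by
  have : Fact (1 < 2 * r) := ⟨by omega⟩
  rw [genHgraph, SimpleGraph.fromRel_adj]
  exact ⟨by simp, .inl (.inl ⟨j, rfl, rfl⟩)⟩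

theorem genHgraph_adj_last (hr : 3 ≤ r) (j : ZMod (2 * r)) :
    (genHgraph ℓ r).Adj (Fin.last (ℓ + 1), j) (Fin.last (ℓ + 1), j + 1) := by
  have : Fact (1 < 2 * r) := ⟨by omega⟩
  rw [genHgraph, SimpleGraph.fromRel_adj]
  exact ⟨by simp, .inl (.inr (.inl ⟨j, rfl, rfl⟩))⟩

theorem genHgraph_adj_rung (hr : 3 ≤ r) {i : Fin (ℓ + 2)} (h1 : 1 ≤ (i : ℕ)) (h2 : (i : ℕ) ≤ ℓ)
    (m : ℕ) :
    (genHgraph ℓ r).Adj (i, ((2 * m : ℕ) : ZMod (2 * r))) (i, ((2 * m : ℕ) : ZMod (2 * r)) + 1) := by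
  have : Fact (1 < 2 * r) := ⟨by omega⟩
  rw [genHgraph, SimpleGraph.fromRel_adj]
  refine ⟨by simp, .inl (.inr (.inr (.inl ⟨i, m % r, h1, h2, Nat.mod_lt _ (by omega), ?_⟩)))⟩
  have : ((2 * (m % r) : ℕ) : ZMod (2 * r)) = ((2 * m : ℕ) : ZMod (2 * r)) := by
    rw [ZMod.natCast_eq_natCast_iff, ← Nat.mul_mod_mul_left]
    exact Nat.mod_modEq _ _
  rw [Nat.cast_succ, this]
  exact ⟨rfl, rfl⟩

theorem genHgraph_adj_rail {i i' : Fin (ℓ + 2)} (h : (i' : ℕ) = i + 1) (j : ZMod (2 * r)) :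
    (genHgraph ℓ r).Adj (i, j) (i', j) := by
  have hi : i' = i + 1 := by
    apply Fin.ext
    rw [Fin.val_add_one_of_lt, h]
    have := i'.isLt
    rw [Fin.lt_def, Fin.val_last]
    omega
  rw [genHgraph, SimpleGraph.fromRel_adj]
  refine ⟨fun he => ?_, .inl (.inr (.inr (.inr ⟨i, j, by omega, rfl, by rw [hi]⟩)))⟩
  have := congrArg Fin.val (Prod.ext_iff.1 he).1
  simp only at this
  omega

/-- An outer cycle together with the three adjacent levels, listed by `lev`, has a vertex of
colour 1 on each edge of the cycle that belongs to a ladder. -/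
theorem colour_one_on_ladder_end (hr : 3 ≤ r) {π : Fin (ℓ + 2) × ZMod (2 * r) → ℕ}
    (hπ : IsPackingColoring (genHgraph ℓ r) 5 π) {lev : Fin 4 → Fin (ℓ + 2)}
    (hlev : Function.Injective lev)
    (hcycle : ∀ j, (genHgraph ℓ r).Adj (lev 0, j) (lev 0, j + 1))
    (hinner : ∀ i, i ≠ 0 → 1 ≤ (lev i : ℕ) ∧ (lev i : ℕ) ≤ ℓ)
    (hrail : ∀ i i' : Fin 4, (i' : ℕ) = i + 1 → ∀ j, (genHgraph ℓ r).Adj (lev i, j) (lev i', j))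
    (m : ℕ) :
    π (lev 0, ((2 * m : ℕ) : ZMod (2 * r))) = 1 ∨ π (lev 0, ((2 * m : ℕ) : ZMod (2 * r)) + 1) = 1 := by
  set φ : Fin 4 × Fin 6 → Fin (ℓ + 2) × ZMod (2 * r) :=
    fun u => (lev u.1, ((2 * (m + r - 1) + u.2.val : ℕ) : ZMod (2 * r))) with hφ
  have hinj : Function.Injective φ := by
    intro u v huv
    obtain ⟨h1, h2⟩ := Prod.ext_iff.1 huv
    simp only [hφ] at h1 h2
    rw [ZMod.natCast_eq_natCast_iff] at h2
    have h3 := Nat.ModEq.add_left_cancel' _ h2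
    refine Prod.ext (hlev h1) (Fin.ext (Nat.ModEq.eq_of_lt_of_lt h3 ?_ ?_)) <;> omega
  have hrow : ∀ (i : Fin 4) (a b : ℕ), (i = 0 ∨ a % 2 = 0) → b = a + 1 →
      (genHgraph ℓ r).Adj (lev i, ((2 * (m + r - 1) + a : ℕ) : ZMod (2 * r)))
        (lev i, ((2 * (m + r - 1) + b : ℕ) : ZMod (2 * r))) := by
    rintro i a b h rfl
    rw [← add_assoc, Nat.cast_succ]
    by_cases hi : i = 0
    · subst hi
      exact hcycle _
    · have ha := h.resolve_left hi
      rw [show 2 * (m + r - 1) + a = 2 * (m + r - 1 + a / 2) by omega]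
      exact genHgraph_adj_rung hr (hinner i hi).1 (hinner i hi).2 _
  have hadj : ∀ u v, windowDist u v = 1 → (genHgraph ℓ r).Adj (φ u) (φ v) := by
    rintro ⟨i, a⟩ ⟨i', b⟩ huv
    rcases windowDist_eq_one_cases _ _ huv with ⟨h, h', h''⟩ | ⟨h, h', h''⟩ | ⟨h, h'⟩ | ⟨h, h'⟩ <;>
      simp only at h h' <;> subst h
    · exact hrow _ _ _ h' h''
    · exact (hrow _ _ _ h' h'').symm
    · exact hrail _ _ h' _
    · exact (hrail _ _ h' _).symm
  have hcast : ((2 * (m + r - 1) + 2 : ℕ) : ZMod (2 * r)) = ((2 * m : ℕ) : ZMod (2 * r)) := by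
    rw [show 2 * (m + r - 1) + 2 = 2 * m + 2 * r by omega, Nat.cast_add, ZMod.natCast_self,
      add_zero]
  have key := hπ.window_middle_colour_one hinj hadj
  have h2 : φ (0, 2) = (lev 0, ((2 * m : ℕ) : ZMod (2 * r))) := Prod.ext rfl hcast
  have h3 : φ (0, 3) = (lev 0, ((2 * m : ℕ) : ZMod (2 * r)) + 1) := by
    refine Prod.ext rfl ?_
    rw [← hcast, ← Nat.cast_succ]
    rfl
  rwa [h2, h3] at key

end GenHgraph

/-- On an even cycle, if no edge has both ends in `P` and every second edge meets `P`, then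
every edge meets `P`. -/
theorem meets_every_edge_of_meets_even_edges {r : ℕ} (hr : r ≠ 0) {P : ZMod (2 * r) → Prop}
    (hindep : ∀ j, ¬(P j ∧ P (j + 1)))
    (heven : ∀ m : ℕ, P (2 * m : ℕ) ∨ P ((2 * m : ℕ) + 1)) (j : ZMod (2 * r)) :
    P j ∨ P (j + 1) := by
  have : NeZero (2 * r) := ⟨by omega⟩
  have hstep : ∀ m : ℕ, ¬P (2 * m : ℕ) → ¬P (2 * (m + 1) : ℕ) := by
    intro m hm h
    refine hindep _ ⟨(heven m).resolve_left hm, ?_⟩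
    convert h using 1
    push_cast
    ring
  obtain ⟨n, rfl⟩ : ∃ n : ℕ, (n : ZMod (2 * r)) = j := ⟨j.val, ZMod.natCast_zmod_val j⟩
  obtain ⟨m, rfl | rfl⟩ := Nat.even_or_odd' n
  · exact heven m
  by_contra! h
  have hm : P (2 * m : ℕ) := (heven m).resolve_right (by simpa using h.1)
  have hnot : ∀ k : ℕ, ¬P (2 * (m + 1 + k) : ℕ) := by
    intro k
    induction k with
    | zero =>
      intro h'
      refine h.2 ?_
      convert h' using 1
      push_cast
      ring
    | succ k ih => exact hstep _ ih
  refine hnot (r - 1) ?_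
  rwa [show 2 * (m + 1 + (r - 1)) = 2 * m + 2 * r by omega, Nat.cast_add, ZMod.natCast_self,
    add_zero]

theorem genHgraph_colour_one_on_outer_cycles (ℓ r : ℕ) (hℓ : 3 ≤ ℓ) (hr : 3 ≤ r)
    (π : Fin (ℓ + 2) × ZMod (2 * r) → ℕ) (hπ : IsPackingColoring (genHgraph ℓ r) 5 π) :
    ∀ j : ZMod (2 * r),
      (π ((0 : Fin (ℓ + 2)), j) = 1 ∨ π ((0 : Fin (ℓ + 2)), j + 1) = 1) ∧
      (π (Fin.last (ℓ + 1), j) = 1 ∨ π (Fin.last (ℓ + 1), j + 1) = 1) := by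
  have hfirst := colour_one_on_ladder_end hr hπ
    (lev := fun i => ⟨i, by omega⟩) (fun a b h => Fin.ext (Fin.mk.inj_iff.1 h))
    (genHgraph_adj_first hr)
    (fun i hi => ⟨Nat.one_le_iff_ne_zero.2 fun h => hi (Fin.ext h), by simp only; omega⟩)
    (fun i i' h j => genHgraph_adj_rail (by exact h) j)
  have hlast := colour_one_on_ladder_end hr hπ
    (lev := fun i => ⟨ℓ + 1 - i, by omega⟩)
    (fun a b h => Fin.ext (by have := Fin.mk.inj_iff.1 h; omega))
    (genHgraph_adj_last hr)
    (fun i hi => by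
      have : (i : ℕ) ≠ 0 := fun h => hi (Fin.ext h)
      simp only
      omega)
    (fun i i' h j => (genHgraph_adj_rail (by simp only; omega) j).symm)
  intro j
  exact ⟨meets_every_edge_of_meets_even_edges (P := fun j => π (0, j) = 1) (by omega)
      (fun j => hπ.not_one_of_adj (genHgraph_adj_first hr j)) hfirst j,
    meets_every_edge_of_meets_even_edges (P := fun j => π (Fin.last (ℓ + 1), j) = 1) (by omega)
      (fun j => hπ.not_one_of_adj (genHgraph_adj_last hr j)) hlast j⟩
end

section
/- Let ℓ ≥ 3 and r ≥ 3 be integers. If the generalised H-graph H^ℓ(r) admits a packing 5-colouring, then it admits a packing 5-colouring π such that π(u^0_j) ∉ {4,5} and π(u^{ℓ+1}_j) ∉ {4,5} for every j with 0 ≤ j ≤ 2r−1. -/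
/-- The distance between `(i, a)` and `(i', b)` in the universal unrolling of the generalised
H-graph with top row `0` and bottom row `n`, whose columns are indexed by `ℤ`. -/
def ladderDist (n i : ℕ) (a : ℤ) (i' : ℕ) (b : ℤ) : ℕ :=
  if a / 2 = b / 2 then ((i : ℤ) - i').natAbs + (a - b).natAbs
  else min (i + i') ((n - i) + (n - i')) + (a - b).natAbs

/-- Vertices in the rows `0, …, n` sharing a colour are farther apart than that colour. -/
def IsLadderPacking (n : ℕ) (f : ℕ → ℤ → ℕ) : Prop :=
  ∀ i ≤ n, ∀ i' ≤ n, ∀ a b : ℤ, (i ≠ i' ∨ a ≠ b) → f i a = f i' b →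
    f i a < ladderDist n i a i' b

/-- A packing `5`-colouring of the unrolled graph with period `2 * r`. -/
structure IsLadderColoring (n r : ℕ) (f : ℕ → ℤ → ℕ) : Prop where
  pos : 0 < r
  range : ∀ i ≤ n, ∀ a, 1 ≤ f i a ∧ f i a ≤ 5
  packing : IsLadderPacking n f
  periodic : ∀ i a, f i (a + 2 * r) = f i a

namespace IsLadderColoring

variable {n r : ℕ} {f : ℕ → ℤ → ℕ}

theorem shift (h : IsLadderColoring n r f) (k : ℤ) :
    IsLadderColoring n r fun i a => f i (2 * k + a) where
  pos := h.pos
  range i hi a := h.range i hi _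
  packing i hi i' hi' a b hab he := by
    have := h.packing i hi i' hi' (2 * k + a) (2 * k + b) (by omega) he
    beta_reduce
    unfold ladderDist at *
    split_ifs at * <;> omega
  periodic i a := by rw [← add_assoc, h.periodic]

theorem mirror (h : IsLadderColoring n r f) :
    IsLadderColoring n r fun i a => f i (1 - a) where
  pos := h.pos
  range i hi a := h.range i hi _
  packing i hi i' hi' a b hab he := by
    have := h.packing i hi i' hi' (1 - a) (1 - b) (by omega) he
    beta_reduce
    unfold ladderDist at *
    split_ifs at * <;> omega
  periodic i a := by
    rw [← h.periodic]
    congr 1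
    ring

theorem flip (h : IsLadderColoring n r f) :
    IsLadderColoring n r fun i a => f (n - i) a where
  pos := h.pos
  range i hi a := h.range _ (by omega) _
  packing i hi i' hi' a b hab he := by
    have := h.packing (n - i) (by omega) (n - i') (by omega) a b (by omega) he
    beta_reduce
    unfold ladderDist at *
    split_ifs at * <;> omega
  periodic i a := h.periodic _ _

end IsLadderColoring

/-- Backtracking search: can the partial colouring `done` be extended to all the given cells,
using the allowed colours only, so that it stays a packing colouring? -/
def extendable (allowed : ℕ × ℕ → List ℕ) :
    List (ℕ × ℕ) → List ((ℕ × ℕ) × ℕ) → Bool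
  | [], _ => true
  | v :: vs, done => (allowed v).any fun c =>
      (done.all fun x => x.2 = c → x.1 ≠ v → c < ladderDist 6 x.1.1 x.1.2 v.1 v.2) &&
      extendable allowed vs ((v, c) :: done)

theorem extendable_of_packing {f : ℕ → ℤ → ℕ} {allowed : ℕ × ℕ → List ℕ} {s : Set (ℕ × ℕ)}
    (hs : ∀ u ∈ s, ∀ v ∈ s, u ≠ v → f u.1 u.2 = f v.1 v.2 →
      f u.1 u.2 < ladderDist 6 u.1 u.2 v.1 v.2)
    (vs : List (ℕ × ℕ)) (hvs : ∀ v ∈ vs, v ∈ s ∧ f v.1 v.2 ∈ allowed v)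
    (done : List ((ℕ × ℕ) × ℕ)) (hdone : ∀ x ∈ done, x.1 ∈ s ∧ x.2 = f x.1.1 x.1.2) :
    extendable allowed vs done = true := by
  induction vs generalizing done with
  | nil => rfl
  | cons v vs ih =>
    have hv := hvs v (by simp)
    rw [extendable, List.any_eq_true]
    refine ⟨f v.1 v.2, hv.2, ?_⟩
    rw [Bool.and_eq_true]
    refine ⟨?_, ih (fun w hw => hvs w (by simp [hw])) _ ?_⟩
    · rw [List.all_eq_true]
      intro x hx
      obtain ⟨hxs, hxc⟩ := hdone x hx
      rw [decide_eq_true_iff]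
      intro hc hne
      rw [← hc, hxc]
      exact hs x.1 hxs v hv.1 hne (hxc.symm.trans hc)
    · intro x hx
      rcases List.mem_cons.1 hx with rfl | hx
      · exact ⟨hv.1, rfl⟩
      · exact hdone x hx

namespace IsLadderColoring

variable {n r : ℕ} {f : ℕ → ℤ → ℕ}

theorem extendable_of_top_rows (h : IsLadderColoring n r f) (hn : 3 ≤ n)
    {allowed : ℕ × ℕ → List ℕ} (vs : List (ℕ × ℕ)) (hrow : ∀ v ∈ vs, v.1 ≤ 3)
    (hvs : ∀ v ∈ vs, f v.1 v.2 ∈ allowed v) : extendable allowed vs [] = true := by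
  refine extendable_of_packing (f := f) (s := {v | v.1 ≤ 3}) ?_ vs
    (fun v hv => ⟨hrow v hv, hvs v hv⟩) [] (by simp)
  rintro ⟨i, a⟩ hi ⟨i', b⟩ hi' hne he
  simp only [Set.mem_ofPred_eq] at hi hi'
  have := h.packing i (by omega) i' (by omega) a b (by simp at hne; omega) he
  simp only
  unfold ladderDist at *
  split_ifs at * <;> omega

theorem mem_colors (h : IsLadderColoring n r f) {i : ℕ} (hi : i ≤ n) (a : ℤ) :
    f i a ∈ [1, 2, 3, 4, 5] := by
  have := h.range i hi a
  simp
  omega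

theorem one_mem_rung_zero (h : IsLadderColoring n r f) (hn : 3 ≤ n) :
    f 0 2 = 1 ∨ f 0 3 = 1 := by
  by_contra! hne
  let allowed : ℕ × ℕ → List ℕ := fun v =>
    if v.1 = 0 ∧ v.2 / 2 = 1 then [2, 3, 4, 5] else [1, 2, 3, 4, 5]
  let cells : List (ℕ × ℕ) :=
    [(0,3), (0,2), (1,2), (1,3), (2,3), (2,2), (3,2), (3,3), (0,4), (1,4), (0,5), (0,1), (1,1),
      (0,0), (1,0), (2,1), (2,4), (1,5)]
  have hsearch : extendable allowed cells [] = false := by decide +kernel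
  have hrow : ∀ v ∈ cells, v.1 ≤ 3 := by decide
  rw [h.extendable_of_top_rows hn cells hrow] at hsearch
  · simp at hsearch
  rintro ⟨i, a⟩ hv
  have hc := h.mem_colors (Nat.le_trans (hrow _ hv) hn) a
  simp only [allowed]
  split_ifs with hia
  · obtain ⟨rfl, ha⟩ := hia
    obtain rfl | rfl : a = 2 ∨ a = 3 := by omega
    · simpa [hne.1] using hc
    · simpa [hne.2] using hc
  · exact hc

theorem one_mem_rung (h : IsLadderColoring n r f) (hn : 3 ≤ n) (k : ℤ) :
    f 0 (2 * k) = 1 ∨ f 0 (2 * k + 1) = 1 := by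
  have := (h.shift (k - 1)).one_mem_rung_zero hn
  ring_nf at this ⊢
  exact this

theorem row_eq_two_or_three (h : IsLadderColoring n r f) (hn : 3 ≤ n)
    (h1 : ∀ k : ℤ, f 0 (2 * k) = 1) : f 0 3 = 2 ∨ f 0 3 = 3 := by
  have h3 := h.packing 0 (by omega) 0 (by omega) 3 2 (by simp)
  have h2 := h1 1
  have hc := h.range 0 (by omega) 3
  by_contra! hne
  let allowed : ℕ × ℕ → List ℕ := fun v =>
    if v.1 = 0 ∧ v.2 % 2 = 0 then [1] else if v.1 = 0 ∧ v.2 = 3 then [4, 5] else [1, 2, 3, 4, 5]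
  let cells : List (ℕ × ℕ) :=
    [(0,4), (0,6), (0,3), (1,6), (0,7), (0,5), (1,4), (1,5), (2,5), (2,4), (3,4)]
  have hsearch : extendable allowed cells [] = false := by decide +kernel
  have hrow : ∀ v ∈ cells, v.1 ≤ 3 := by decide
  rw [h.extendable_of_top_rows hn cells hrow] at hsearch
  · simp at hsearch
  rintro ⟨i, a⟩ hv
  have hia := h.mem_colors (Nat.le_trans (hrow _ hv) hn) a
  simp only [allowed]
  split_ifs with hp hq
  · obtain ⟨rfl, ha⟩ := hp
    have := h1 (a / 2 : ℕ)
    rw [show 2 * ((a / 2 : ℕ) : ℤ) = (a : ℤ) by omega] at this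
    simp [this]
  · obtain ⟨rfl, rfl⟩ := hq
    have : f 0 3 ≠ 1 := by
      intro h4
      have := h3 (by simpa [h4] using h2.symm)
      simp [ladderDist, h4] at this
    simp
    omega
  · exact hia

theorem eq_of_dvd (h : IsLadderColoring n r f) (i : ℕ) {a b : ℤ} (hab : (2 * r : ℤ) ∣ b - a) :
    f i b = f i a := by
  obtain ⟨t, ht⟩ := hab
  have hper : Function.Periodic (f i) (2 * r : ℤ) := h.periodic i
  rw [← hper.int_mul t a]
  congr 1
  push_cast
  linarith

theorem one_left_or_one_right (h : IsLadderColoring n r f) (hn : 3 ≤ n) :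
    (∀ k : ℤ, f 0 (2 * k) = 1) ∨ ∀ k : ℤ, f 0 (2 * k + 1) = 1 := by
  by_contra! hne
  obtain ⟨⟨k, hk⟩, l, hl⟩ := hne
  have step : ∀ k : ℤ, f 0 (2 * k) ≠ 1 → f 0 (2 * (k + 1)) ≠ 1 := by
    intro k hk hk'
    have h1 := (h.one_mem_rung hn k).resolve_left hk
    have := h.packing 0 (by omega) 0 (by omega) (2 * k + 1) (2 * (k + 1)) (by omega) (by omega)
    unfold ladderDist at this
    split_ifs at this <;> omega
  have steps : ∀ m : ℕ, f 0 (2 * (k + m)) ≠ 1 := by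
    intro m
    induction m with
    | zero => simpa using hk
    | succ m ih =>
      have := step _ ih
      push_cast
      rwa [← add_assoc]
  have hm : (0 : ℤ) ≤ l - k + (l - k).natAbs * r := by
    have := h.pos
    nlinarith [neg_le_abs (l - k), abs_nonneg (l - k), Int.natCast_natAbs (l - k)]
  obtain ⟨m, hm⟩ := Int.eq_ofNat_of_zero_le hm
  have hl' := steps m
  rw [h.eq_of_dvd 0 (a := 2 * l) ⟨(l - k).natAbs, by rw [← hm]; ring⟩] at hl'
  exact hl ((h.one_mem_rung hn l).resolve_left hl')

theorem even (h : IsLadderColoring n r f) (hn : 3 ≤ n) : Even r := by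
  wlog h1 : ∀ k : ℤ, f 0 (2 * k) = 1 generalizing f
  · refine this h.mirror fun k => ?_
    have := ((h.one_left_or_one_right hn).resolve_left h1) (-k)
    ring_nf at this ⊢
    exact this
  have hcol : ∀ k : ℤ, f 0 (2 * k + 1) = 2 ∨ f 0 (2 * k + 1) = 3 := by
    intro k
    have := (h.shift (k - 1)).row_eq_two_or_three hn fun l => by
      simpa [mul_add] using h1 (k - 1 + l)
    ring_nf at this ⊢
    exact this
  have hne : ∀ k : ℤ, f 0 (2 * k + 1) ≠ f 0 (2 * (k + 1) + 1) := by
    intro k he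
    have := h.packing 0 (by omega) 0 (by omega) _ _ (by omega) he
    have := hcol k
    unfold ladderDist at *
    split_ifs at * <;> omega
  have halt : ∀ m : ℕ, f 0 (2 * m + 1) = f 0 1 ↔ Even m := by
    intro m
    induction m with
    | zero => simp
    | succ m ih =>
      have a := hcol m
      have b := hcol (m + 1)
      have c := hne m
      have d := hcol 0
      rw [Nat.even_add_one, ← ih]
      push_cast
      simp only [mul_zero, zero_add] at d
      omega
  refine (halt r).1 ?_
  rw [add_comm, h.periodic]

theorem row_zero_le_three (h : IsLadderColoring n r f) (hn : 3 ≤ n) (a : ℤ) : f 0 a ≤ 3 := by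
  wlog h1 : ∀ k : ℤ, f 0 (2 * k) = 1 generalizing f a
  · have := this h.mirror (1 - a) fun k => by
      have := ((h.one_left_or_one_right hn).resolve_left h1) (-k)
      ring_nf at this ⊢
      exact this
    simpa using this
  obtain ⟨k, rfl | rfl⟩ := Int.even_or_odd' a
  · simp [h1]
  · have := (h.shift (k - 1)).row_eq_two_or_three hn fun l => by
      simpa [mul_add] using h1 (k - 1 + l)
    ring_nf at this ⊢
    omega

theorem ne_six (h : IsLadderColoring n r f) : n ≠ 6 := by
  rintro rfl
  wlog h1 : ∀ k : ℤ, f 0 (2 * k) = 1 generalizing f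
  · refine this h.mirror fun k => ?_
    have := ((h.one_left_or_one_right (by omega)).resolve_left h1) (-k)
    ring_nf at this ⊢
    exact this
  let allowed : ℕ × ℕ → List ℕ := fun v =>
    if v.1 = 0 then if v.2 % 2 = 0 then [1] else [2, 3]
    else if v.1 = 6 then [1, 2, 3] else [1, 2, 3, 4, 5]
  let cells : List (ℕ × ℕ) :=
    [(0,4), (0,2), (0,3), (0,1), (0,5), (1,2), (1,4), (1,3), (2,3), (3,3), (6,3), (6,2), (6,4),
      (6,1), (5,2), (4,3), (4,2), (3,2), (2,2)]
  have hsearch : extendable allowed cells [] = false := by decide +kernel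
  have hrow : ∀ v ∈ cells, v.1 ≤ 6 := by decide
  rw [extendable_of_packing (f := f) (s := {v | v.1 ≤ 6})] at hsearch
  · simp at hsearch
  · rintro ⟨i, a⟩ hi ⟨i', b⟩ hi' hne he
    exact h.packing i hi i' hi' a b (by simp at hne; omega) he
  · rintro ⟨i, a⟩ hv
    refine ⟨hrow _ hv, ?_⟩
    have hc := h.mem_colors (hrow _ hv) a
    simp only [allowed]
    split_ifs with hp hq hq
    · have := h1 (a / 2 : ℕ)
      rw [show 2 * ((a / 2 : ℕ) : ℤ) = (a : ℤ) by omega] at this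
      simp [hp, this]
    · subst hp
      have h3 := h.row_zero_le_three (by omega) a
      have h2 := h1 (a / 2 : ℕ)
      have := h.range 0 (by omega) a
      have := h.packing 0 (by omega) 0 (by omega) a (2 * (a / 2 : ℕ)) (by omega)
      simp
      unfold ladderDist at this
      split_ifs at this <;> omega
    · subst hq
      have h3 : f 6 a ≤ 3 := by simpa using h.flip.row_zero_le_three (by omega) a
      have := h.range 6 (by omega) a
      simp
      omega
    · exact hc
  · simp

end IsLadderColoring

/-- A colour word `s` for one side of a ladder with rows `0, …, n`: letters `2, 3` recur at
distance at least `3`, letters `4, 5` at distance at least `5`, and the two ends are normalised. -/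
structure IsLadderWord (n : ℕ) (s : ℕ → ℕ) : Prop where
  range : ∀ i, 2 ≤ s i ∧ s i ≤ 5
  gap : ∀ i i', i < i' → s i = s i' → i + 3 ≤ i' ∧ (4 ≤ s i → i + 5 ≤ i')
  top : s 0 ≤ 3 ∧ 4 ≤ s 1 ∧ s 2 ≤ 3
  bottom : s n ≤ 3 ∧ 4 ≤ s (n - 1) ∧ s (n - 2) ≤ 3

/-- The periodic word `3 4 2 3 5 2 …`. -/
def periodicWord (i : ℕ) : ℕ :=
  if i % 3 = 0 then 3 else if i % 3 = 2 then 2 else if i % 6 = 1 then 4 else 5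

/-- The word `2 5` followed by the periodic word. -/
def shiftedWord (i : ℕ) : ℕ :=
  if i = 0 then 2 else if i = 1 then 5 else periodicWord (i - 2)

/-- The word `3 5 2 4 3` followed by the shifted word. -/
def doublyShiftedWord (i : ℕ) : ℕ :=
  if i = 0 then 3 else if i = 1 then 5 else if i = 2 then 2 else if i = 3 then 4
  else if i = 4 then 3 else shiftedWord (i - 5)

theorem periodicWord_gap {i i' : ℕ} (hi : i < i') (h : periodicWord i = periodicWord i') :
    i + 3 ≤ i' ∧ (4 ≤ periodicWord i → i + 5 ≤ i') := by
  unfold periodicWord at *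
  split_ifs at * <;> omega

theorem periodicWord_range (i : ℕ) : 2 ≤ periodicWord i ∧ periodicWord i ≤ 5 := by
  unfold periodicWord
  split_ifs <;> omega

theorem shiftedWord_add (i : ℕ) : shiftedWord (i + 2) = periodicWord i := by
  simp [shiftedWord]

theorem shiftedWord_range (i : ℕ) : 2 ≤ shiftedWord i ∧ shiftedWord i ≤ 5 := by
  have := periodicWord_range (i - 2)
  unfold shiftedWord
  split_ifs <;> omega

theorem shiftedWord_gap {i i' : ℕ} (hi : i < i') (h : shiftedWord i = shiftedWord i') :
    i + 3 ≤ i' ∧ (4 ≤ shiftedWord i → i + 5 ≤ i') := by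
  by_cases h2 : i < 2
  · by_contra hc
    have : i' < 6 := by omega
    interval_cases i <;> interval_cases i' <;> revert h hc <;> decide
  · obtain ⟨i, rfl⟩ := Nat.exists_eq_add_of_le' (not_lt.1 h2)
    obtain ⟨i', rfl⟩ := Nat.exists_eq_add_of_le' ((not_lt.1 h2).trans hi.le)
    rw [shiftedWord_add, shiftedWord_add] at h
    have := periodicWord_gap (by omega) h
    rw [shiftedWord_add]
    omega

theorem doublyShiftedWord_add (i : ℕ) : doublyShiftedWord (i + 5) = shiftedWord i := by
  simp [doublyShiftedWord]

theorem doublyShiftedWord_range (i : ℕ) :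
    2 ≤ doublyShiftedWord i ∧ doublyShiftedWord i ≤ 5 := by
  have := shiftedWord_range (i - 5)
  unfold doublyShiftedWord
  split_ifs <;> omega

theorem doublyShiftedWord_gap {i i' : ℕ} (hi : i < i')
    (h : doublyShiftedWord i = doublyShiftedWord i') :
    i + 3 ≤ i' ∧ (4 ≤ doublyShiftedWord i → i + 5 ≤ i') := by
  by_cases h5 : i < 5
  · by_contra hc
    have : i' < 9 := by omega
    interval_cases i <;> interval_cases i' <;> revert h hc <;> decide
  · obtain ⟨i, rfl⟩ := Nat.exists_eq_add_of_le' (not_lt.1 h5)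
    obtain ⟨i', rfl⟩ := Nat.exists_eq_add_of_le' ((not_lt.1 h5).trans hi.le)
    rw [doublyShiftedWord_add, doublyShiftedWord_add] at h
    have := shiftedWord_gap (by omega) h
    rw [doublyShiftedWord_add]
    omega

theorem exists_isLadderWord {n : ℕ} (hn : 4 ≤ n) (hn6 : n ≠ 6) : ∃ s, IsLadderWord n s := by
  obtain h | h | h : n % 3 = 2 ∨ n % 3 = 1 ∨ n % 3 = 0 := by omega
  · refine ⟨periodicWord, periodicWord_range, fun _ _ => periodicWord_gap, by decide, ?_⟩
    unfold periodicWord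
    split_ifs <;> omega
  · refine ⟨shiftedWord, shiftedWord_range, fun _ _ => shiftedWord_gap, by decide, ?_⟩
    obtain ⟨m, rfl⟩ : ∃ m, n = m + 2 + 2 := ⟨n - 4, by omega⟩
    rw [shiftedWord_add, show m + 2 + 2 - 1 = m + 1 + 2 by omega, shiftedWord_add,
      show m + 2 + 2 - 2 = m + 2 by omega, shiftedWord_add]
    unfold periodicWord
    split_ifs <;> omega
  · refine ⟨doublyShiftedWord, doublyShiftedWord_range, fun _ _ => doublyShiftedWord_gap,
      by decide, ?_⟩
    obtain ⟨m, rfl⟩ : ∃ m, n = m + 2 + 2 + 5 := ⟨n - 9, by omega⟩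
    rw [show m + 2 + 2 + 5 - 1 = m + 1 + 2 + 5 by omega,
      show m + 2 + 2 + 5 - 2 = m + 2 + 5 by omega]
    simp only [doublyShiftedWord_add, shiftedWord_add]
    unfold periodicWord
    split_ifs <;> omega

/-- The involution exchanging `2` with `3` and `4` with `5`. -/
def swapColor (c : ℕ) : ℕ := if c = 2 then 3 else if c = 3 then 2 else if c = 4 then 5 else 4

/-- The colouring of the unrolled graph in which colour `1` is one side of the bipartition and
the other side of the ladders carries alternately the word `s` and its image under the swap. -/
def wordColoring (s : ℕ → ℕ) (i : ℕ) (a : ℤ) : ℕ :=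
  if (i + a) % 2 = 0 then 1 else if a % 4 < 2 then s i else swapColor (s i)

theorem wordColoring_of_odd {s : ℕ → ℕ} {i : ℕ} {a : ℤ} (hs : 2 ≤ s i ∧ s i ≤ 5)
    (h : (i + a) % 2 ≠ 0) :
    2 ≤ wordColoring s i a ∧ wordColoring s i a ≤ 5 ∧ (wordColoring s i a ≤ 3 ↔ s i ≤ 3) := by
  unfold wordColoring swapColor
  split_ifs <;> omega

theorem wordColoring_eq_iff {s : ℕ → ℕ} {i i' : ℕ} {a b : ℤ} (hs : 2 ≤ s i ∧ s i ≤ 5)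
    (hs' : 2 ≤ s i' ∧ s i' ≤ 5) (h : (i + a) % 2 ≠ 0) (h' : (i' + b) % 2 ≠ 0)
    (he : wordColoring s i a = wordColoring s i' b) :
    s i = s i' ↔ (a % 4 < 2 ↔ b % 4 < 2) := by
  rw [wordColoring, if_neg h, wordColoring, if_neg h'] at he
  unfold swapColor at he
  split_ifs at he <;> omega

/-- The separation estimate for two vertices in different ladders, at distances `p` and `q` from
the outer cycle through which a shortest path runs. -/
theorem lt_add_of_near_end {p q x x' c d : ℕ} (hc : 2 ≤ c ∧ c ≤ 5 ∧ (c ≤ 3 ↔ x ≤ 3))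
    (hc' : 2 ≤ c ∧ c ≤ 5 ∧ (c ≤ 3 ↔ x' ≤ 3)) (hd : 1 ≤ d) (hpar : (p + q + d) % 2 = 0)
    (hpq : p = q → d ≠ 2) (hx : (p = 0 → x ≤ 3) ∧ (p = 1 → 4 ≤ x) ∧ (p = 2 → x ≤ 3))
    (hx' : (q = 0 → x' ≤ 3) ∧ (q = 1 → 4 ≤ x') ∧ (q = 2 → x' ≤ 3)) : c < p + q + d := by
  by_contra! h
  have hp : p < 5 := by omega
  have hq : q < 5 := by omega
  interval_cases p <;> interval_cases q <;> omega

theorem IsLadderWord.isLadderPacking {n : ℕ} {s : ℕ → ℕ} (hs : IsLadderWord n s) (hn : 4 ≤ n) :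
    IsLadderPacking n (wordColoring s) := by
  intro i hi i' hi' a b hab he
  have hflip : ∀ d, (i + i' + d) % 2 = 0 → (n - i + (n - i') + d) % 2 = 0 := by omega
  by_contra! hd
  have hi1 := hs.range i
  have hi2 := hs.range i'
  have hg1 := hs.gap i i'
  have hg2 := hs.gap i' i
  obtain ⟨ht0, ht1, ht2⟩ := hs.top
  obtain ⟨hb0, hb1, hb2⟩ := hs.bottom
  by_cases hp : (i + a) % 2 = 0
  · have hp' : (i' + b) % 2 = 0 := by
      by_contra hp'
      have := wordColoring_of_odd hi2 hp'
      rw [← he, wordColoring, if_pos hp] at this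
      omega
    rw [wordColoring, if_pos hp] at hd
    unfold ladderDist at hd
    split_ifs at hd <;> omega
  have hp' : (i' + b) % 2 ≠ 0 := by
    intro hp'
    have := wordColoring_of_odd hi1 hp
    rw [he, wordColoring, if_pos hp'] at this
    omega
  have hpar : (i + i' + (a - b).natAbs) % 2 = 0 := by
    clear hi1 hi2 hg1 hg2 hd ht0 ht1 ht2 hb0 hb1 hb2
    omega
  have hc := wordColoring_of_odd hi1 hp
  have hc' := wordColoring_of_odd hi2 hp'
  have hiff := wordColoring_eq_iff hi1 hi2 hp hp' he
  rw [← he] at hc'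
  generalize wordColoring s i a = c at hc hc' hd
  clear he
  unfold ladderDist at hd
  by_cases hl : a / 2 = b / 2
  · rw [if_pos hl] at hd
    have hs' : s i = s i' := hiff.2 (by omega)
    omega
  · rw [if_neg hl] at hd
    have hd1 : 1 ≤ (a - b).natAbs := Int.natAbs_pos.2 fun h => hl (by rw [sub_eq_zero.1 h])
    have hd2 : i = i' → (a - b).natAbs ≠ 2 := by
      rintro rfl
      have := hiff.1 rfl
      clear hg1 hg2 hd hc hc' hiff
      omega
    rcases le_total (i + i') ((n - i) + (n - i')) with hm | hm
    · rw [min_eq_left hm] at hd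
      exact hd.not_gt (lt_add_of_near_end hc hc' hd1 hpar hd2
        ⟨fun h => h ▸ ht0, fun h => h ▸ ht1, fun h => h ▸ ht2⟩
        ⟨fun h => h ▸ ht0, fun h => h ▸ ht1, fun h => h ▸ ht2⟩)
    · rw [min_eq_right hm] at hd
      have hend : ∀ j ≤ n, (n - j = 0 → s j ≤ 3) ∧ (n - j = 1 → 4 ≤ s j) ∧
          (n - j = 2 → s j ≤ 3) := by
        intro j hj
        refine ⟨fun h => ?_, fun h => ?_, fun h => ?_⟩
        · rwa [show j = n by omega]
        · rwa [show j = n - 1 by omega]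
        · rwa [show j = n - 2 by omega]
      exact hd.not_gt (lt_add_of_near_end hc hc' hd1 (hflip _ hpar) (fun h => hd2 (by omega))
        (hend i hi) (hend i' hi'))

theorem IsLadderWord.isLadderColoring {n r : ℕ} {s : ℕ → ℕ} (hs : IsLadderWord n s) (hn : 4 ≤ n)
    (hpos : 0 < r) (hr : Even r) : IsLadderColoring n r (wordColoring s) where
  pos := hpos
  range i _ a := by
    by_cases h : (i + a) % 2 = 0
    · simp [wordColoring, h]
    · have := wordColoring_of_odd (hs.range i) h
      omega
  packing := hs.isLadderPacking hn
  periodic i a := by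
    obtain ⟨k, rfl⟩ := hr
    have h2 : (i + (a + 2 * (k + k : ℕ))) % 2 = (i + a) % 2 := by omega
    have h4 : (a + 2 * (k + k : ℕ)) % 4 = a % 4 := by omega
    rw [wordColoring, wordColoring, h2, h4]

theorem wordColoring_le_three {s : ℕ → ℕ} {i : ℕ} (h2 : 2 ≤ s i) (h3 : s i ≤ 3) (a : ℤ) :
    wordColoring s i a ≤ 3 := by
  by_cases h : (i + a) % 2 = 0
  · simp [wordColoring, h]
  · exact (wordColoring_of_odd ⟨h2, by omega⟩ h).2.2.2 h3

theorem SimpleGraph.edist_le_of_chain {V : Type*} {G : SimpleGraph V} (g : ℕ → V) (m : ℕ)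
    (h : ∀ k < m, G.Adj (g k) (g (k + 1))) : G.edist (g 0) (g m) ≤ m := by
  induction m with
  | zero => simp
  | succ m ih =>
    refine (SimpleGraph.edist_triangle (v := g m)).trans ?_
    push_cast
    exact add_le_add (ih fun k hk => h k (by omega))
      (SimpleGraph.edist_eq_one_iff_adj.2 (h m (by omega))).le

theorem IsPackingColoring.lt_of_edist_le {V : Type*} {G : SimpleGraph V} {k : ℕ} {π : V → ℕ}
    (h : IsPackingColoring G k π) {u v : V} (hne : u ≠ v) (he : π u = π v) {d : ℕ}
    (hd : G.edist u v ≤ d) : π u < d := by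
  obtain ⟨p, hp⟩ := SimpleGraph.exists_walk_of_edist_ne_top
    (ne_top_of_le_ne_top (ENat.natCast_ne_top d) hd)
  rw [← hp] at hd
  exact (h.2 u v hne he p).trans_le (by exact_mod_cast hd)

/-- The vertex of the generalised H-graph in row `i` and column `a` modulo `2 * r`. -/
def genHvertex (ℓ r i : ℕ) (a : ℤ) : Fin (ℓ + 2) × ZMod (2 * r) := (Fin.ofNat (ℓ + 2) i, a)

theorem Fin.ofNat_val_of_lt {n i : ℕ} [NeZero n] (h : i < n) : (Fin.ofNat n i : ℕ) = i := by
  simp [Fin.ofNat, Nat.mod_eq_of_lt h]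

section

variable {ℓ r : ℕ}

theorem genHvertex_eq_iff {i i' : ℕ} (hi : i ≤ ℓ + 1) (hi' : i' ≤ ℓ + 1) (a b : ℤ) :
    genHvertex ℓ r i a = genHvertex ℓ r i' b ↔ i = i' ∧ (2 * r : ℤ) ∣ b - a := by
  rw [genHvertex, genHvertex, Prod.mk.injEq, ZMod.intCast_eq_intCast_iff_dvd_sub, Fin.ext_iff,
    Fin.ofNat_val_of_lt (by omega), Fin.ofNat_val_of_lt (by omega)]
  push_cast
  rfl

theorem genHgraph_adj_rail_s15 {i : ℕ} (hi : i ≤ ℓ) (a : ℤ) :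
    (genHgraph ℓ r).Adj (genHvertex ℓ r i a) (genHvertex ℓ r (i + 1) a) := by
  rw [genHgraph, SimpleGraph.fromRel_adj, Ne, genHvertex_eq_iff (by omega) (by omega)]
  refine ⟨by omega, Or.inl (Or.inr (Or.inr (Or.inr ⟨Fin.ofNat _ i, a, ?_, rfl, ?_⟩)))⟩
  · rwa [Fin.ofNat_val_of_lt (by omega)]
  · have hi' := Fin.ofNat_val_of_lt (n := ℓ + 2) (i := i) (by omega)
    rw [genHvertex, Prod.mk.injEq, Fin.ext_iff, Fin.val_add_one_of_lt' (by omega), hi',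
      Fin.ofNat_val_of_lt (by omega)]
    exact ⟨rfl, rfl⟩

theorem not_two_mul_dvd_one : ¬ (2 * r : ℤ) ∣ 1 := fun h => by
  have := (Dvd.intro _ rfl : (2 : ℤ) ∣ 2 * r).trans h
  omega

theorem genHgraph_adj_row {i : ℕ} (hi : i = 0 ∨ i = ℓ + 1) (a : ℤ) :
    (genHgraph ℓ r).Adj (genHvertex ℓ r i a) (genHvertex ℓ r i (a + 1)) := by
  rw [genHgraph, SimpleGraph.fromRel_adj, Ne, genHvertex_eq_iff (by omega) (by omega)]
  refine ⟨by simpa using not_two_mul_dvd_one, Or.inl ?_⟩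
  rcases hi with rfl | rfl
  · exact Or.inl ⟨a, by simp [genHvertex], by simp [genHvertex]⟩
  · exact Or.inr (Or.inl ⟨a, by simp [genHvertex], by simp [genHvertex]⟩)

theorem genHgraph_adj_rung_s15 (hr : 0 < r) {i : ℕ} (hi : i ≤ ℓ + 1) {a : ℤ} (ha : a % 2 = 0) :
    (genHgraph ℓ r).Adj (genHvertex ℓ r i a) (genHvertex ℓ r i (a + 1)) := by
  by_cases hrow : i = 0 ∨ i = ℓ + 1
  · exact genHgraph_adj_row hrow a
  rw [genHgraph, SimpleGraph.fromRel_adj, Ne, genHvertex_eq_iff hi hi]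
  refine ⟨by simpa using not_two_mul_dvd_one, Or.inl (Or.inr (Or.inr (Or.inl ?_)))⟩
  have hpos := Int.emod_nonneg (a / 2) (show (r : ℤ) ≠ 0 by omega)
  have hlt := Int.emod_lt_of_pos (a / 2) (show (0 : ℤ) < r by omega)
  obtain ⟨j, hj⟩ := Int.eq_ofNat_of_zero_le hpos
  have hcast : ((a : ℤ) : ZMod (2 * r)) = ((2 * j : ℕ) : ZMod (2 * r)) := by
    rw [← Int.cast_natCast, ZMod.intCast_eq_intCast_iff_dvd_sub]
    refine ⟨-(a / 2 / r), ?_⟩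
    have := Int.emod_add_mul_ediv (a / 2) r
    push_cast
    linarith [Int.emod_add_mul_ediv a 2]
  refine ⟨Fin.ofNat _ i, j, ?_, ?_, by omega, ?_, ?_⟩
  · rw [Fin.ofNat_val_of_lt] <;> omega
  · rw [Fin.ofNat_val_of_lt] <;> omega
  · rw [genHvertex, hcast]
  · rw [genHvertex]
    push_cast at hcast ⊢
    rw [hcast]

theorem genHgraph_edist_rail {i i' : ℕ} (hi : i ≤ ℓ + 1) (hi' : i' ≤ ℓ + 1) (a : ℤ) :
    (genHgraph ℓ r).edist (genHvertex ℓ r i a) (genHvertex ℓ r i' a) ≤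
      ((i : ℤ) - i').natAbs := by
  wlog h : i ≤ i' generalizing i i'
  · rw [SimpleGraph.edist_comm, ← Int.natAbs_neg, neg_sub]
    exact this hi' hi (by omega)
  obtain ⟨m, rfl⟩ := Nat.exists_eq_add_of_le h
  rw [show ((i : ℤ) - (i + m : ℕ)).natAbs = m by omega]
  exact SimpleGraph.edist_le_of_chain (fun k => genHvertex ℓ r (i + k) a) m
    fun k hk => genHgraph_adj_rail_s15 (by omega) a

theorem genHgraph_edist_row {i : ℕ} (hi : i = 0 ∨ i = ℓ + 1) (a b : ℤ) :
    (genHgraph ℓ r).edist (genHvertex ℓ r i a) (genHvertex ℓ r i b) ≤ (a - b).natAbs := by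
  wlog h : a ≤ b generalizing a b
  · rw [SimpleGraph.edist_comm, ← Int.natAbs_neg, neg_sub]
    exact this b a (by omega)
  obtain ⟨m, rfl⟩ := Int.le.dest h
  rw [show (a - (a + m)).natAbs = m by omega]
  have := SimpleGraph.edist_le_of_chain (G := genHgraph ℓ r)
    (fun k => genHvertex ℓ r i (a + k)) m fun k hk => by
      have := genHgraph_adj_row (r := r) hi (a + k)
      push_cast
      rwa [← add_assoc]
  simpa using this

theorem genHgraph_edist_rung (hr : 0 < r) {i : ℕ} (hi : i ≤ ℓ + 1) {a b : ℤ}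
    (h : a / 2 = b / 2) :
    (genHgraph ℓ r).edist (genHvertex ℓ r i a) (genHvertex ℓ r i b) ≤ (a - b).natAbs := by
  wlog hab : a ≤ b generalizing a b
  · rw [SimpleGraph.edist_comm, ← Int.natAbs_neg, neg_sub]
    exact this h.symm (by omega)
  obtain rfl | ⟨rfl, ha⟩ : a = b ∨ b = a + 1 ∧ a % 2 = 0 := by omega
  · simp
  · rw [SimpleGraph.edist_eq_one_iff_adj.2 (genHgraph_adj_rung_s15 hr hi ha)]
    simp

theorem genHgraph_edist_le_ladderDist (hr : 0 < r) {i i' : ℕ} (hi : i ≤ ℓ + 1)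
    (hi' : i' ≤ ℓ + 1) (a b : ℤ) :
    (genHgraph ℓ r).edist (genHvertex ℓ r i a) (genHvertex ℓ r i' b) ≤
      ladderDist (ℓ + 1) i a i' b := by
  have key : ∀ e, e = 0 ∨ e = ℓ + 1 →
      (genHgraph ℓ r).edist (genHvertex ℓ r i a) (genHvertex ℓ r i' b) ≤
        (((i : ℤ) - e).natAbs + (a - b).natAbs + ((e : ℤ) - i').natAbs : ℕ) := by
    intro e he
    have hel : e ≤ ℓ + 1 := by omega
    push_cast
    exact (SimpleGraph.edist_triangle (v := genHvertex ℓ r e b)).trans (add_le_add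
      ((SimpleGraph.edist_triangle (v := genHvertex ℓ r e a)).trans (add_le_add
        (genHgraph_edist_rail hi hel a) (genHgraph_edist_row he a b)))
      (genHgraph_edist_rail hel hi' b))
  unfold ladderDist
  split_ifs with h
  · push_cast
    exact (SimpleGraph.edist_triangle (v := genHvertex ℓ r i' a)).trans (add_le_add
      (genHgraph_edist_rail hi hi' a) (genHgraph_edist_rung hr hi' h))
  · rcases le_total (i + i') ((ℓ + 1 - i) + (ℓ + 1 - i')) with hm | hm
    · rw [min_eq_left hm]
      exact (key 0 (Or.inl rfl)).trans (Nat.cast_le.2 (by push_cast; omega))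
    · rw [min_eq_right hm]
      exact (key (ℓ + 1) (Or.inr rfl)).trans (Nat.cast_le.2 (by push_cast; omega))

theorem IsPackingColoring.isLadderColoring (hr : 3 ≤ r)
    {π : Fin (ℓ + 2) × ZMod (2 * r) → ℕ} (h : IsPackingColoring (genHgraph ℓ r) 5 π) :
    IsLadderColoring (ℓ + 1) r fun i a => π (genHvertex ℓ r i a) where
  pos := by omega
  range i hi a := h.1 _
  periodic i a := by
    congr 1
    rw [genHvertex, genHvertex, Prod.mk.injEq, ZMod.intCast_eq_intCast_iff_dvd_sub]
    exact ⟨rfl, -1, by push_cast; ring⟩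
  packing i hi i' hi' a b hab he := by
    beta_reduce at he ⊢
    by_cases hfar : 6 ≤ (a - b).natAbs
    · have := (h.1 (genHvertex ℓ r i a)).2
      unfold ladderDist
      split_ifs <;> omega
    · refine h.lt_of_edist_le ?_ he (genHgraph_edist_le_ladderDist (by omega) hi hi' a b)
      rw [Ne, genHvertex_eq_iff hi hi']
      rintro ⟨rfl, hdvd⟩
      have := Int.natAbs_le_of_dvd_ne_zero hdvd (by omega)
      omega

theorem genHgraph_adj_lift {i i' : Fin (ℓ + 2)} {x x' : ZMod (2 * r)}
    (h : (genHgraph ℓ r).Adj (i, x) (i', x')) {a : ℤ} (ha : (a : ZMod (2 * r)) = x) :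
    ∃ b : ℤ, (b : ZMod (2 * r)) = x' ∧
      (i = i' ∧ (a - b).natAbs = 1 ∧ (a / 2 = b / 2 ∨ (i : ℕ) = 0 ∨ (i : ℕ) = ℓ + 1) ∨
        a = b ∧ ((i : ℤ) - i').natAbs = 1) := by
  have parity : ∀ {a : ℤ} {j : ℕ}, (a : ZMod (2 * r)) = (j : ZMod (2 * r)) → a % 2 = j % 2 := by
    intro a j h
    rw [← Int.cast_natCast, ZMod.intCast_eq_intCast_iff_dvd_sub] at h
    have := (Dvd.intro r (by push_cast; ring) : (2 : ℤ) ∣ (2 * r : ℕ)).trans h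
    omega
  rw [genHgraph, SimpleGraph.fromRel_adj] at h
  obtain ⟨-, h | h⟩ := h
  · obtain ⟨j, h, h'⟩ | ⟨j, h, h'⟩ | ⟨k, j, -, -, -, h, h'⟩ | ⟨k, j, hk, h, h'⟩ := h <;>
      rw [Prod.mk.injEq] at h h' <;> obtain ⟨rfl, rfl⟩ := h <;> obtain ⟨rfl, rfl⟩ := h'
    · exact ⟨a + 1, by simp [ha], Or.inl ⟨rfl, by omega, by simp⟩⟩
    · exact ⟨a + 1, by simp [ha], Or.inl ⟨rfl, by omega, by simp⟩⟩
    · have := parity ha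
      exact ⟨a + 1, by simp [ha], Or.inl ⟨rfl, by omega, by omega⟩⟩
    · refine ⟨a, ha, Or.inr ⟨rfl, ?_⟩⟩
      rw [Fin.val_add_one_of_lt' (by omega)]
      omega
  · obtain ⟨j, h, h'⟩ | ⟨j, h, h'⟩ | ⟨k, j, -, -, -, h, h'⟩ | ⟨k, j, hk, h, h'⟩ := h <;>
      rw [Prod.mk.injEq] at h h' <;> obtain ⟨rfl, rfl⟩ := h <;> obtain ⟨rfl, rfl⟩ := h'
    · exact ⟨a - 1, by simp [ha], Or.inl ⟨rfl, by omega, by simp⟩⟩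
    · exact ⟨a - 1, by simp [ha], Or.inl ⟨rfl, by omega, by simp⟩⟩
    · have := parity ha
      exact ⟨a - 1, by simp [ha], Or.inl ⟨rfl, by omega, by omega⟩⟩
    · refine ⟨a, ha, Or.inr ⟨rfl, ?_⟩⟩
      rw [Fin.val_add_one_of_lt' (by omega)]
      omega

theorem genHgraph_walk_lift {u v : Fin (ℓ + 2) × ZMod (2 * r)} (p : (genHgraph ℓ r).Walk u v)
    {b : ℤ} (hb : (b : ZMod (2 * r)) = v.2) :
    ∃ a : ℤ, (a : ZMod (2 * r)) = u.2 ∧ ladderDist (ℓ + 1) u.1 a v.1 b ≤ p.length := by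
  induction p with
  | nil => exact ⟨b, hb, by simp [ladderDist]⟩
  | @cons u w v h p ih =>
    obtain ⟨a, ha, hd⟩ := ih hb
    obtain ⟨a', ha', hstep⟩ := genHgraph_adj_lift h.symm ha
    refine ⟨a', ha', ?_⟩
    rw [SimpleGraph.Walk.length_cons]
    have hu := u.1.isLt
    have hw := w.1.isLt
    have hv := v.1.isLt
    rw [Fin.ext_iff] at hstep
    unfold ladderDist at *
    split_ifs at * <;> omega

theorem isPackingColoring_of_isLadderColoring {f : ℕ → ℤ → ℕ}
    (h : IsLadderColoring (ℓ + 1) r f) :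
    IsPackingColoring (genHgraph ℓ r) 5 fun v => f v.1 v.2.cast := by
  refine ⟨fun v => h.range _ (by omega) _, fun u v hne he p => ?_⟩
  obtain ⟨a, ha, hd⟩ := genHgraph_walk_lift p (ZMod.intCast_zmod_cast v.2)
  have hfa : f u.1 u.2.cast = f u.1 a := by
    refine h.eq_of_dvd _ ?_
    have := (ZMod.intCast_eq_intCast_iff_dvd_sub a u.2.cast (2 * r)).1
      (ha.trans (ZMod.intCast_zmod_cast u.2).symm)
    exact_mod_cast this
  beta_reduce at he ⊢
  rw [hfa] at he ⊢
  refine (h.packing _ (by omega) _ (by omega) a _ ?_ he).trans_le hd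
  by_contra! hc
  refine hne (Prod.ext (Fin.ext hc.1) ?_)
  rw [← ha, hc.2, ZMod.intCast_zmod_cast]

end

theorem genHgraph_exists_no45_on_outer_cycles (ℓ r : ℕ) (hℓ : 3 ≤ ℓ) (hr : 3 ≤ r)
    (h : ∃ π : Fin (ℓ + 2) × ZMod (2 * r) → ℕ, IsPackingColoring (genHgraph ℓ r) 5 π) :
    ∃ π : Fin (ℓ + 2) × ZMod (2 * r) → ℕ, IsPackingColoring (genHgraph ℓ r) 5 π ∧
      ∀ j : ZMod (2 * r),
        π ((0 : Fin (ℓ + 2)), j) ∉ ({4, 5} : Set ℕ) ∧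
        π (Fin.last (ℓ + 1), j) ∉ ({4, 5} : Set ℕ) := by
  obtain ⟨π, hπ⟩ := h
  have hf := hπ.isLadderColoring hr
  obtain ⟨s, hs⟩ := exists_isLadderWord (n := ℓ + 1) (by omega) hf.ne_six
  have hg := hs.isLadderColoring (by omega) (by omega) (hf.even (by omega))
  refine ⟨_, isPackingColoring_of_isLadderColoring hg, fun j => ?_⟩
  have h0 := wordColoring_le_three (hs.range 0).1 hs.top.1 j.cast
  have h1 := wordColoring_le_three (hs.range (ℓ + 1)).1 hs.bottom.1 j.cast
  simp only [Set.mem_insert_iff, Set.mem_singleton_iff, Fin.val_zero, Fin.val_last]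
  omega
end

section
/- For every integer ℓ ≥ 3 and every odd integer r ≥ 3, the packing chromatic number of the generalised H-graph H^ℓ(r) is at least 6. -/
namespace GenHgraph

/-! ### Exhaustive search for colourings of a finite set of vertices -/

/-- An upper bound for the distance of `(i, j)` and `(i', j')` (level, column) in a generalised
H-graph, attained by a path inside a single ladder or through level `0`. -/
def ladderDist (u v : ℕ × ℕ) : ℕ :=
  (if u.2 / 2 = v.2 / 2 then (u.1 - v.1) + (v.1 - u.1) else u.1 + v.1) +
    ((u.2 - v.2) + (v.2 - u.2))

/-- Two vertices are compatible for a colouring if they have different colours or are further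
apart than their common colour. -/
def Compatible (f : ℕ × ℕ → ℕ) (u v : ℕ × ℕ) : Prop :=
  f u = f v → f u < ladderDist u v

/-- Backtracking search: can the partial colouring `a` be extended to the vertices in the list,
each coming with the list of its admissible colours? -/
def extendable : List ((ℕ × ℕ) × List ℕ) → List ((ℕ × ℕ) × ℕ) → Bool
  | [], _ => true
  | x :: t, a => x.2.any fun k =>
      (a.all fun p => !(Nat.beq p.2 k) || Nat.blt k (ladderDist p.1 x.1)) &&
        extendable t ((x.1, k) :: a)

theorem extendable_eq_true (f : ℕ × ℕ → ℕ) (t : List ((ℕ × ℕ) × List ℕ))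
    (a : List ((ℕ × ℕ) × ℕ)) (hdom : ∀ x ∈ t, f x.1 ∈ x.2) (ha : ∀ p ∈ a, p.2 = f p.1)
    (hat : ∀ p ∈ a, ∀ x ∈ t, Compatible f p.1 x.1)
    (ht : t.Pairwise fun x y => Compatible f x.1 y.1) : extendable t a = true := by
  induction t generalizing a with
  | nil => rfl
  | cons x t ih =>
    rw [List.pairwise_cons] at ht
    rw [extendable, List.any_eq_true]
    refine ⟨f x.1, hdom x (by simp), ?_⟩
    rw [Bool.and_eq_true, List.all_eq_true]
    refine ⟨fun p hp => ?_, ih _ (fun y hy => hdom y (by simp [hy])) ?_ ?_ ht.2⟩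
    · have h := hat p hp x (by simp)
      rw [Compatible, ← ha p hp] at h
      by_cases hk : p.2 = f x.1
      · have := h hk
        simp [hk] at this ⊢
        exact this
      · simp [Bool.eq_false_iff, hk]
    · intro p hp
      rcases List.mem_cons.1 hp with rfl | hp
      · rfl
      · exact ha p hp
    · intro p hp y hy
      rcases List.mem_cons.1 hp with rfl | hp
      · exact ht.1 y hy
      · exact hat p hp y (by simp [hy])

/-- The vertices to be coloured, with the admissible colours prescribed by `dom`. -/
def searchList (dom : ℕ × ℕ → List ℕ) (l : List (ℕ × ℕ)) : List ((ℕ × ℕ) × List ℕ) :=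
  l.map fun v => (v, dom v)

/-- The admissible colours when the rung in columns `2`, `3` at level `0` avoids colour `1`. -/
def domNoOne (v : ℕ × ℕ) : List ℕ :=
  if v = (0, 2) ∨ v = (0, 3) then [2, 3, 4, 5] else [1, 2, 3, 4, 5]

/-- The admissible colours when even columns have colour `1` at level `0` and column `1` has a
colour above `3`. -/
def domEven (v : ℕ × ℕ) : List ℕ :=
  if v = (0, 0) ∨ v = (0, 2) ∨ v = (0, 4) then [1]
  else if v = (0, 1) then [4, 5] else [1, 2, 3, 4, 5]

/-- The admissible colours when odd columns have colour `1` at level `0` and column `4` has a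
colour above `3`. -/
def domOdd (v : ℕ × ℕ) : List ℕ :=
  if v = (0, 1) ∨ v = (0, 3) ∨ v = (0, 5) then [1]
  else if v = (0, 4) then [4, 5] else [1, 2, 3, 4, 5]

/-- A search order for `domNoOne`. -/
def orderNoOne : List (ℕ × ℕ) :=
  [(0,2),(0,3),(0,1),(1,1),(0,0),(1,0),(2,1),(2,0),(1,2),(1,3),(2,2),(2,3),(3,3),(3,2),(0,4),
    (0,5),(1,4),(2,4),(1,5),(3,0),(3,1),(3,5),(3,4),(2,5)]

/-- A search order for `domEven`. -/
def orderEven : List (ℕ × ℕ) :=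
  [(0,4),(0,2),(0,1),(0,3),(1,2),(1,3),(2,3),(2,2),(3,2),(1,4),(0,5),(0,0),(2,1),(1,5),(3,5),
    (2,4),(3,3),(1,1),(1,0),(2,5),(3,4),(3,1),(2,0),(3,0)]

/-- A search order for `domOdd`. -/
def orderOdd : List (ℕ × ℕ) :=
  [(0,3),(0,1),(0,4),(0,2),(0,0),(1,1),(1,3),(1,2),(2,2),(2,3),(3,3),(1,0),(1,4),(3,4),(3,2),
    (2,5),(1,5),(0,5),(3,1),(3,5),(3,0),(2,4),(2,0),(2,1)]

theorem not_extendable_noOne : extendable (searchList domNoOne orderNoOne) [] = false := by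
  decide +kernel

theorem not_extendable_even : extendable (searchList domEven orderEven) [] = false := by
  decide +kernel

theorem not_extendable_odd : extendable (searchList domOdd orderOdd) [] = false := by
  decide +kernel

/-! ### Colourings of the infinite strip -/

/-- A colouring of the levels `0, …, 3` of the infinite strip with colours `1, …, 5` which
satisfies the packing condition for vertices at most five columns apart. -/
structure IsStripColoring (f : ℕ × ℕ → ℕ) : Prop where
  pos : ∀ v : ℕ × ℕ, 1 ≤ f v
  le_five : ∀ v : ℕ × ℕ, f v ≤ 5
  compatible : ∀ u v : ℕ × ℕ, u.1 ≤ 3 → v.1 ≤ 3 → u ≠ v → u.2 ≤ v.2 + 5 → v.2 ≤ u.2 + 5 →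
    Compatible f u v

namespace IsStripColoring

variable {f : ℕ × ℕ → ℕ}

theorem shift (hf : IsStripColoring f) (k : ℕ) :
    IsStripColoring fun v => f (v.1, 2 * k + v.2) where
  pos _ := hf.pos _
  le_five _ := hf.le_five _
  compatible u v hu hv huv h₁ h₂ h := by
    have := hf.compatible (u.1, 2 * k + u.2) (v.1, 2 * k + v.2) hu hv
      (fun he => huv (by simp only [Prod.mk.injEq] at he; ext <;> omega))
      (by simp only; omega) (by simp only; omega) h
    have e : ladderDist (u.1, 2 * k + u.2) (v.1, 2 * k + v.2) = ladderDist u v := by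
      have e₁ (x : ℕ) : (2 * k + x) / 2 = k + x / 2 := by omega
      simp only [ladderDist, e₁, Nat.add_left_cancel_iff, Nat.add_sub_add_left]
    rwa [e] at this

theorem mem_colors (hf : IsStripColoring f) (v : ℕ × ℕ) : f v ∈ [1, 2, 3, 4, 5] := by
  have h₁ := hf.pos v
  have h₂ := hf.le_five v
  simp only [List.mem_cons, List.not_mem_nil, or_false]
  omega

theorem extendable_searchList (hf : IsStripColoring f) {dom : ℕ × ℕ → List ℕ}
    {l : List (ℕ × ℕ)} (hdom : ∀ v, f v ∈ dom v) (hl : l.Nodup)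
    (hbd : ∀ v ∈ l, v.1 ≤ 3 ∧ v.2 ≤ 5) : extendable (searchList dom l) [] = true := by
  refine extendable_eq_true f _ _ ?_ (by simp) (by simp) ?_
  · intro x hx
    obtain ⟨v, -, rfl⟩ := List.mem_map.1 hx
    exact hdom v
  · refine List.pairwise_map.2 (List.Pairwise.imp_of_mem ?_ hl)
    intro u v hu hv huv
    have h₁ := hbd u hu
    have h₂ := hbd v hv
    exact hf.compatible u v h₁.1 h₂.1 huv (by omega) (by omega)

theorem exists_one_aux (hf : IsStripColoring f) : f (0, 2) = 1 ∨ f (0, 3) = 1 := by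
  by_contra! h
  have := hf.extendable_searchList (dom := domNoOne) (l := orderNoOne) (fun v => by
    have hv := hf.mem_colors v
    unfold domNoOne
    split_ifs with hc
    · rcases hc with rfl | rfl <;> simp_all
    · exact hv) (by decide) (by decide)
  simp [not_extendable_noOne] at this

theorem le_three_of_even_aux (hf : IsStripColoring f) (h₀ : f (0, 0) = 1) (h₂ : f (0, 2) = 1)
    (h₄ : f (0, 4) = 1) : f (0, 1) ≤ 3 := by
  by_contra! h
  have := hf.extendable_searchList (dom := domEven) (l := orderEven) (fun v => by
    have hv := hf.mem_colors v
    unfold domEven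
    split_ifs with hc hd
    · rcases hc with rfl | rfl | rfl <;> simpa
    · subst hd
      have := hf.le_five (0, 1)
      simp only [List.mem_cons, List.not_mem_nil, or_false]
      omega
    · exact hv) (by decide) (by decide)
  simp [not_extendable_even] at this

theorem le_three_of_odd_aux (hf : IsStripColoring f) (h₁ : f (0, 1) = 1) (h₃ : f (0, 3) = 1)
    (h₅ : f (0, 5) = 1) : f (0, 4) ≤ 3 := by
  by_contra! h
  have := hf.extendable_searchList (dom := domOdd) (l := orderOdd) (fun v => by
    have hv := hf.mem_colors v
    unfold domOdd
    split_ifs with hc hd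
    · rcases hc with rfl | rfl | rfl <;> simpa
    · subst hd
      have := hf.le_five (0, 4)
      simp only [List.mem_cons, List.not_mem_nil, or_false]
      omega
    · exact hv) (by decide) (by decide)
  simp [not_extendable_odd] at this

theorem exists_one (hf : IsStripColoring f) (k : ℕ) :
    f (0, 2 * k + 2) = 1 ∨ f (0, 2 * k + 3) = 1 :=
  (hf.shift k).exists_one_aux

theorem ne_one_succ (hf : IsStripColoring f) {j : ℕ} (h : f (0, j) = 1) : f (0, j + 1) ≠ 1 := by
  intro h'
  have := hf.compatible (0, j) (0, j + 1) (by simp) (by simp) (by simp) (by simp; omega)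
    (by simp) (h.trans h'.symm)
  simp [ladderDist, h] at this

theorem ne_add_two (hf : IsStripColoring f) {j : ℕ} (h : 2 ≤ f (0, j)) :
    f (0, j + 2) ≠ f (0, j) := by
  intro h'
  have := hf.compatible (0, j) (0, j + 2) (by simp) (by simp) (by simp) (by simp; omega)
    (by simp) h'.symm
  simp [ladderDist] at this
  omega

/-- From some column on, level `0` has colour `1` in every second column, and the colours `2` and
`3` alternate in the remaining columns. -/
theorem exists_alternating (hf : IsStripColoring f) :
    ∃ m, ∀ k, (f (0, m + 2 * k) = 2 ∨ f (0, m + 2 * k) = 3) ∧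
      f (0, m + 2 * (k + 1)) ≠ f (0, m + 2 * k) := by
  suffices h : ∃ m, ∀ k, 2 ≤ f (0, m + 2 * k) ∧ f (0, m + 2 * k) ≤ 3 by
    obtain ⟨m, hm⟩ := h
    exact ⟨m, fun k => ⟨by have := hm k; omega, hf.ne_add_two (hm k).1⟩⟩
  have two_le {j : ℕ} (h : f (0, j) ≠ 1) : 2 ≤ f (0, j) := by
    have := hf.pos (0, j)
    omega
  by_cases hodd : ∃ n, f (0, 2 * n + 1) = 1
  · obtain ⟨n, hn⟩ := hodd
    have key (k : ℕ) : f (0, 2 * (n + k) + 1) = 1 := by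
      induction k with
      | zero => exact hn
      | succ k ih => exact (hf.exists_one (n + k)).resolve_left (hf.ne_one_succ ih)
    refine ⟨2 * n + 4, fun k => ⟨two_le fun h => hf.ne_one_succ h ?_, ?_⟩⟩
    · convert key (k + 2) using 3
      ring
    · convert (hf.shift (n + k)).le_three_of_odd_aux (key k) (key (k + 1)) (key (k + 2)) using 3
      ring
  · push Not at hodd
    have key (k : ℕ) : f (0, 2 * k + 2) = 1 := (hf.exists_one k).resolve_right (hodd (k + 1))
    refine ⟨3, fun k => ⟨two_le ?_, ?_⟩⟩
    · rw [show 3 + 2 * k = 2 * (k + 1) + 1 by ring]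
      exact hodd (k + 1)
    · convert (hf.shift (k + 1)).le_three_of_even_aux (key k) (key (k + 1)) (key (k + 2)) using 3
      ring

theorem not_periodic (hf : IsStripColoring f) {r : ℕ} (hr : Odd r) :
    ¬ ∀ j, f (0, j + 2 * r) = f (0, j) := by
  intro hper
  obtain ⟨m, hm⟩ := hf.exists_alternating
  have key (n : ℕ) : f (0, m + 2 * (2 * n)) = f (0, m) := by
    induction n with
    | zero => rfl
    | succ n ih =>
      have h₀ := hm (2 * n)
      have h₁ := hm (2 * n + 1)
      have h₂ := hm (2 * n + 1 + 1)
      rw [← ih, show 2 * (n + 1) = 2 * n + 1 + 1 by ring]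
      omega
  obtain ⟨n, rfl⟩ := hr
  exact (hm (2 * n)).2 ((hper m).trans (key n).symm)

end IsStripColoring

/-! ### Walks in generalised H-graphs -/

section Walks

variable {ℓ r : ℕ}

/-- The vertex in level `v.1` and column `v.2`, for natural numbers taken modulo `ℓ + 2` and
`2 * r`. -/
def vertex (ℓ r : ℕ) (v : ℕ × ℕ) : Fin (ℓ + 2) × ZMod (2 * r) :=
  (Fin.ofNat (ℓ + 2) v.1, (v.2 : ZMod (2 * r)))

theorem vertex_injective_of_near (hr : 3 ≤ r) {u v : ℕ × ℕ} (hu : u.1 ≤ ℓ + 1)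
    (hv : v.1 ≤ ℓ + 1) (h₁ : u.2 ≤ v.2 + 5) (h₂ : v.2 ≤ u.2 + 5)
    (h : vertex ℓ r u = vertex ℓ r v) : u = v := by
  simp only [vertex, Prod.mk.injEq, Fin.ext_iff, Fin.val_ofNat] at h
  obtain ⟨hl, hc⟩ := h
  rw [Nat.mod_eq_of_lt (by omega), Nat.mod_eq_of_lt (by omega)] at hl
  have hc' := (ZMod.natCast_eq_natCast_iff _ _ _).1 hc
  refine Prod.ext hl ?_
  rcases le_total u.2 v.2 with h | h
  · have := Nat.eq_zero_of_dvd_of_lt ((Nat.modEq_iff_dvd' h).1 hc') (by omega)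
    omega
  · have := Nat.eq_zero_of_dvd_of_lt ((Nat.modEq_iff_dvd' h).1 hc'.symm) (by omega)
    omega

/-- There is a walk of length `n` between the vertices `u` and `v`. -/
def Joined (ℓ r n : ℕ) (u v : ℕ × ℕ) : Prop :=
  ∃ p : (genHgraph ℓ r).Walk (vertex ℓ r u) (vertex ℓ r v), p.length = n

namespace Joined

theorem refl (u : ℕ × ℕ) : Joined ℓ r 0 u u := ⟨.nil, rfl⟩

theorem symm {n : ℕ} {u v : ℕ × ℕ} : Joined ℓ r n u v → Joined ℓ r n v u := by
  rintro ⟨p, hp⟩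
  exact ⟨p.reverse, by simpa⟩

theorem trans {m n : ℕ} {u v w : ℕ × ℕ} :
    Joined ℓ r m u v → Joined ℓ r n v w → Joined ℓ r (m + n) u w := by
  rintro ⟨p, hp⟩ ⟨q, hq⟩
  exact ⟨p.append q, by simp [hp, hq]⟩

theorem of_adj {u v : ℕ × ℕ} (h : (genHgraph ℓ r).Adj (vertex ℓ r u) (vertex ℓ r v)) :
    Joined ℓ r 1 u v := ⟨h.toWalk, by simp⟩

theorem level_succ (hr : 3 ≤ r) {i : ℕ} (hi : i ≤ ℓ) (j : ℕ) :
    Joined ℓ r 1 (i, j) (i + 1, j) := by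
  refine of_adj ((SimpleGraph.fromRel_adj _ _ _).2 ⟨fun h => ?_, Or.inl ?_⟩)
  · simpa using vertex_injective_of_near hr (by simp only; omega) (by simp only; omega)
      (by simp only; omega) (by simp only; omega) h
  · refine Or.inr (Or.inr (Or.inr ⟨Fin.ofNat _ i, j, ?_, rfl, ?_⟩))
    · rw [Fin.val_ofNat]
      exact (Nat.mod_le _ _).trans hi
    · simp [vertex, Fin.ext_iff, Fin.val_add]

theorem column_succ (hr : 3 ≤ r) (j : ℕ) : Joined ℓ r 1 (0, j) (0, j + 1) := by
  refine of_adj ((SimpleGraph.fromRel_adj _ _ _).2 ⟨fun h => ?_, Or.inl ?_⟩)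
  · simpa using vertex_injective_of_near hr (by simp) (by simp)
      (by simp only; omega) (by simp only; omega) h
  · exact Or.inl ⟨j, rfl, by simp [vertex]⟩

theorem rung (hr : 3 ≤ r) {i : ℕ} (hi : i ≤ ℓ) (k : ℕ) :
    Joined ℓ r 1 (i, 2 * k) (i, 2 * k + 1) := by
  rcases Nat.eq_zero_or_pos i with rfl | hpos
  · exact column_succ hr _
  refine of_adj ((SimpleGraph.fromRel_adj _ _ _).2 ⟨fun h => ?_, Or.inl ?_⟩)
  · simpa using vertex_injective_of_near hr (by simp only; omega) (by simp only; omega)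
      (by simp only; omega) (by simp only; omega) h
  · have hv : (Fin.ofNat (ℓ + 2) i : ℕ) = i := Nat.mod_eq_of_lt (by omega)
    have hc : ((2 * k : ℕ) : ZMod (2 * r)) = (2 * (k % r) : ℕ) := by
      rw [ZMod.natCast_eq_natCast_iff', Nat.mul_mod_mul_left, Nat.mul_mod_mul_left, Nat.mod_mod]
    refine Or.inr (Or.inr (Or.inl ⟨Fin.ofNat _ i, k % r, by omega, by omega,
      Nat.mod_lt _ (by omega), ?_, ?_⟩))
    · rw [vertex, hc]
    · rw [vertex, Nat.cast_add, hc, ← Nat.cast_add]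

theorem level_add (hr : 3 ≤ r) {i n : ℕ} (h : i + n ≤ ℓ + 1) (j : ℕ) :
    Joined ℓ r n (i, j) (i + n, j) := by
  induction n with
  | zero => exact refl _
  | succ n ih => exact (ih (by omega)).trans (level_succ hr (by omega) j)

theorem level (hr : 3 ≤ r) {i i' : ℕ} (hi : i ≤ ℓ + 1) (hi' : i' ≤ ℓ + 1) (j : ℕ) :
    Joined ℓ r ((i - i') + (i' - i)) (i, j) (i', j) := by
  rcases le_total i i' with h | h
  · obtain ⟨n, rfl⟩ := Nat.exists_eq_add_of_le h
    simpa using level_add hr hi' j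
  · obtain ⟨n, rfl⟩ := Nat.exists_eq_add_of_le h
    simpa using (level_add hr hi j).symm

theorem column_add (hr : 3 ≤ r) (j n : ℕ) : Joined ℓ r n (0, j) (0, j + n) := by
  induction n with
  | zero => exact refl _
  | succ n ih => exact ih.trans (column_succ hr _)

theorem of_column_le (hr : 3 ≤ r) {u v : ℕ × ℕ} (hu : u.1 ≤ ℓ) (hv : v.1 ≤ ℓ)
    (h : u.2 ≤ v.2) : Joined ℓ r (ladderDist u v) u v := by
  obtain ⟨i, j⟩ := u
  obtain ⟨i', j'⟩ := v
  simp only at hu hv h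
  obtain ⟨n, rfl⟩ := Nat.exists_eq_add_of_le h
  have hn : j - (j + n) + (j + n - j) = n := by omega
  rw [ladderDist, hn]
  split_ifs with hl
  · have hvert := level (ℓ := ℓ) hr (i := i) (i' := i') (by omega) (by omega) j
    refine hvert.trans ?_
    simp only at hl
    obtain rfl | ⟨rfl, hj⟩ : n = 0 ∨ n = 1 ∧ j = 2 * (j / 2) := by omega
    · exact refl _
    · rw [hj]
      exact rung hr hv _
  · have h₁ := level (ℓ := ℓ) hr (i := i) (i' := 0) (by omega) (by omega) j
    have h₂ := level (ℓ := ℓ) hr (i := 0) (i' := i') (by omega) (by omega) (j + n)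
    simp only [Nat.sub_zero, Nat.zero_sub, Nat.add_zero, Nat.zero_add] at h₁ h₂
    have := (h₁.trans (column_add hr j n)).trans h₂
    rwa [show i + n + i' = i + i' + n by ring] at this

end Joined

theorem ladderDist_comm (u v : ℕ × ℕ) : ladderDist u v = ladderDist v u := by
  simp only [ladderDist, eq_comm (a := u.2 / 2)]
  split_ifs <;> ring

theorem joined_ladderDist (hr : 3 ≤ r) {u v : ℕ × ℕ} (hu : u.1 ≤ ℓ) (hv : v.1 ≤ ℓ) :
    Joined ℓ r (ladderDist u v) u v := by
  rcases le_total u.2 v.2 with h | h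
  · exact Joined.of_column_le hr hu hv h
  · rw [ladderDist_comm]
    exact (Joined.of_column_le hr hv hu h).symm

theorem isStripColoring (hℓ : 3 ≤ ℓ) (hr : 3 ≤ r) {π : Fin (ℓ + 2) × ZMod (2 * r) → ℕ} {k : ℕ}
    (hk : k ≤ 5) (hπ : IsPackingColoring (genHgraph ℓ r) k π) :
    IsStripColoring fun v => π (vertex ℓ r v) where
  pos _ := (hπ.1 _).1
  le_five _ := (hπ.1 _).2.trans hk
  compatible u v hu hv huv h₁ h₂ h := by
    obtain ⟨p, hp⟩ := joined_ladderDist hr (hu.trans hℓ) (hv.trans hℓ)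
    rw [← hp]
    exact hπ.2 _ _ (fun he => huv (vertex_injective_of_near hr (by omega) (by omega) h₁ h₂ he))
      h p

end Walks

end GenHgraph

/-- Every finite graph has a packing colouring, namely one with pairwise distinct colours. -/
theorem exists_isPackingColoring {V : Type*} [Finite V] (G : SimpleGraph V) :
    ∃ k, ∃ π : V → ℕ, IsPackingColoring G k π := by
  refine ⟨Nat.card V, fun v => Finite.equivFin V v + 1, fun v => ⟨Nat.le_add_left _ _, Fin.is_lt _⟩, ?_⟩
  intro u v huv h
  refine absurd ((Finite.equivFin V).injective (Fin.ext ?_)) huv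
  simpa using h

theorem genHgraph_odd_ge_six (ℓ r : ℕ) (hℓ : 3 ≤ ℓ) (hr : 3 ≤ r) (hodd : Odd r) :
    6 ≤ packingChromaticNumber (genHgraph ℓ r) := by
  by_contra! h
  have : NeZero (2 * r) := ⟨by omega⟩
  obtain ⟨π, hπ⟩ := Nat.sInf_mem (exists_isPackingColoring (genHgraph ℓ r))
  refine (GenHgraph.isStripColoring hℓ hr (Nat.le_of_lt_succ h) hπ).not_periodic hodd fun j => ?_
  have hj : ((j + 2 * r : ℕ) : ZMod (2 * r)) = j := by
    rw [Nat.cast_add, ZMod.natCast_self, add_zero]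
  simp only [GenHgraph.vertex, hj]
end

section
/- For every pair of integers ℓ ≥ 3 with ℓ ≠ 5 and r ≥ 2, the packing chromatic number of the generalised H-graph H^ℓ(r) equals 5 if r is even, and equals 6 if r is odd. -/
/-- Two vertices of `genHgraph ℓ r` lie on the same ladder. -/
def SameLadder {ℓ r : ℕ} (u v : Fin (ℓ + 2) × ZMod (2 * r)) : Prop :=
  u.2.val / 2 = v.2.val / 2

lemma two_mul_val_succ {r : ℕ} (hr : 2 ≤ r) (j : ZMod (2 * r)) :
    (j + 1).val = (j.val + 1) % (2 * r) := by
  have : Fact (1 < 2 * r) := ⟨by omega⟩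
  rw [ZMod.val_add, ZMod.val_one]

lemma genHgraph_adj_cases {ℓ r : ℕ} {u v : Fin (ℓ + 2) × ZMod (2 * r)}
    (h : (genHgraph ℓ r).Adj u v) :
    (u.2 = v.2 ∧ ((u.1 : ℕ) = v.1 + 1 ∨ (v.1 : ℕ) = u.1 + 1)) ∨
    (u.1 = v.1 ∧ (v.2 = u.2 + 1 ∨ u.2 = v.2 + 1) ∧
      (SameLadder u v ∨ (u.1 : ℕ) = 0 ∨ (u.1 : ℕ) = ℓ + 1)) := by
  have key : ∀ j : ℕ, j < r → ((2 * j : ℕ) : ZMod (2 * r)).val / 2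
      = ((2 * j + 1 : ℕ) : ZMod (2 * r)).val / 2 := by
    intro j hj
    rw [ZMod.val_natCast, ZMod.val_natCast, Nat.mod_eq_of_lt (by omega),
      Nat.mod_eq_of_lt (by omega)]
    omega
  have val_succ : ∀ i : Fin (ℓ + 2), (i : ℕ) ≤ ℓ → ((i + 1 : Fin (ℓ + 2)) : ℕ) = i + 1 := by
    intro i hi
    rw [Fin.val_add_one_of_lt]
    exact Fin.lt_def.2 (by simp; omega)
  rw [genHgraph, SimpleGraph.fromRel_adj] at h
  obtain ⟨-, h | h⟩ := h <;>
  rcases h with ⟨j, rfl, rfl⟩ | ⟨j, rfl, rfl⟩ | ⟨i, j, h1, h2, hj, rfl, rfl⟩ | ⟨i, j, hi, rfl, rfl⟩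
  · simp
  · simp
  · right
    exact ⟨rfl, Or.inl (by push_cast; ring), Or.inl (key j hj)⟩
  · left; exact ⟨rfl, Or.inr (val_succ i hi)⟩
  · simp
  · simp
  · right
    exact ⟨rfl, Or.inr (by push_cast; ring), Or.inl (key j hj).symm⟩
  · left; exact ⟨rfl, Or.inl (val_succ i hi)⟩

/-- The three routes a walk of length at most `n` from `u` to `v` can take: staying on one ladder,
through the cycle on level `0`, or through the cycle on level `ℓ + 1`. -/
def Near {ℓ r : ℕ} (u v : Fin (ℓ + 2) × ZMod (2 * r)) (n : ℕ) : Prop :=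
  (SameLadder u v ∧
    |(u.1 : ℤ) - v.1| + (if u.2.val % 2 = v.2.val % 2 then 0 else 1) ≤ n) ∨
  (∃ d : ℤ, v.2 = u.2 + d ∧ (u.1 : ℤ) + v.1 + |d| ≤ n) ∨
  (∃ d : ℤ, v.2 = u.2 + d ∧ (ℓ + 1 - u.1 : ℤ) + (ℓ + 1 - v.1) + |d| ≤ n)

lemma SameLadder.exists_shift {ℓ r : ℕ} (hr : 2 ≤ r) {u v : Fin (ℓ + 2) × ZMod (2 * r)}
    (h : SameLadder u v) :
    ∃ d : ℤ, v.2 = u.2 + d ∧ |d| = if u.2.val % 2 = v.2.val % 2 then 0 else 1 := by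
  have : NeZero (2 * r) := ⟨by omega⟩
  refine ⟨(v.2.val : ℤ) - u.2.val, by simp, ?_⟩
  unfold SameLadder at h
  split_ifs <;> [rw [abs_eq_zero]; rw [abs_eq one_pos.le]] <;> omega

lemma Near.of_adj {ℓ r : ℕ} (hr : 2 ≤ r) {u u' v : Fin (ℓ + 2) × ZMod (2 * r)} {n : ℕ}
    (ha : (genHgraph ℓ r).Adj u u') (h : Near u' v n) : Near u v (n + 1) := by
  obtain ⟨hc, hl⟩ | ⟨hl, hc, hs⟩ := genHgraph_adj_cases ha
  · unfold Near SameLadder at h ⊢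
    rw [hc]
    obtain ⟨h1, h2⟩ | ⟨d, h1, h2⟩ | ⟨d, h1, h2⟩ := h
    · refine Or.inl ⟨h1, ?_⟩
      revert h2
      generalize (if u'.2.val % 2 = v.2.val % 2 then (0 : ℤ) else 1) = e
      intro h2
      push_cast
      grind
    · exact Or.inr (Or.inl ⟨d, h1, by push_cast; omega⟩)
    · exact Or.inr (Or.inr ⟨d, h1, by push_cast; omega⟩)
  · obtain ⟨e, he, hea⟩ : ∃ e : ℤ, u'.2 = u.2 + e ∧ |e| ≤ 1 := by
      rcases hc with hc | hc
      · exact ⟨1, by simp [hc], by simp⟩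
      · exact ⟨-1, by simp [hc], by simp⟩
    have shift : ∀ d : ℤ, v.2 = u'.2 + d → v.2 = u.2 + ((e + d : ℤ) : ZMod (2 * r)) := by
      intro d hd
      rw [hd, he]; push_cast; ring
    rcases h with ⟨h1, h2⟩ | ⟨d, h1, h2⟩ | ⟨d, h1, h2⟩
    · by_cases hs' : SameLadder u u'
      · refine Or.inl ⟨hs'.trans h1, ?_⟩
        rw [hl]
        push_cast
        split_ifs at h2 ⊢ <;> omega
      · obtain ⟨d, hd, hda⟩ := h1.exists_shift hr
        rw [← hda] at h2
        have := abs_add_le e d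
        rcases hs.resolve_left hs' with h0 | h0
        · refine Or.inr (Or.inl ⟨e + d, shift d hd, ?_⟩)
          rw [← hl, h0] at h2
          rw [h0]
          push_cast at h2 ⊢
          rw [abs_of_nonpos (by omega)] at h2
          omega
        · refine Or.inr (Or.inr ⟨e + d, shift d hd, ?_⟩)
          rw [← hl, h0] at h2
          rw [h0]
          have := v.1.isLt
          push_cast at h2 ⊢
          rw [abs_of_nonneg (by omega)] at h2
          omega
    · have := abs_add_le e d
      exact Or.inr (Or.inl ⟨e + d, shift d h1, by rw [hl]; push_cast; omega⟩)
    · have := abs_add_le e d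
      exact Or.inr (Or.inr ⟨e + d, shift d h1, by rw [hl]; push_cast; omega⟩)

lemma near_of_walk {ℓ r : ℕ} (hr : 2 ≤ r) {u v : Fin (ℓ + 2) × ZMod (2 * r)}
    (p : (genHgraph ℓ r).Walk u v) : Near u v p.length := by
  induction p with
  | nil => exact Or.inl ⟨rfl, by simp⟩
  | cons ha p ih => exact Near.of_adj hr ha ih

/-- The colour at side `s` of a ladder rung coloured by the two decimal digits of `a`. -/
def rungColor (a s : ℕ) : ℕ := if s = 0 then a / 10 else a % 10

/-- Two rungs of one ladder, `d` levels apart, obey the packing condition. -/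
def RungsCompatible (a b d : ℕ) : Prop :=
  ∀ s < 2, ∀ t < 2, rungColor a s = rungColor b t →
    rungColor a s < d + if s = t then 0 else 1

instance (a b d : ℕ) : Decidable (RungsCompatible a b d) := by
  unfold RungsCompatible; infer_instance

/-- A list of rungs is a packing `k`-colouring of a ladder (for `k ≤ 6`). -/
def LadderColoring (k : ℕ) : List ℕ → Prop
  | [] => True
  | a :: w => (∀ s < 2, 1 ≤ rungColor a s ∧ rungColor a s ≤ k) ∧ a / 10 ≠ a % 10 ∧
      (∀ d < 6, ∀ b ∈ (w.take 6)[d]?, RungsCompatible a b (d + 1)) ∧ LadderColoring k w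

instance LadderColoring.decidable (k : ℕ) : ∀ w, Decidable (LadderColoring k w)
  | [] => isTrue trivial
  | a :: w =>
    have := LadderColoring.decidable k w
    inferInstanceAs (Decidable ((∀ s < 2, 1 ≤ rungColor a s ∧ rungColor a s ≤ k) ∧
      a / 10 ≠ a % 10 ∧ (∀ d < 6, ∀ b ∈ (w.take 6)[d]?, RungsCompatible a b (d + 1)) ∧
      LadderColoring k w))

/-- The colour on level `i` and side `s` of a ladder coloured by `w`. -/
def ladderColor (w : List ℕ) (i s : ℕ) : ℕ := rungColor (w.getD i 0) s

/-- The columns that may follow the column `q`, a column being given by the type of its ladder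
and its side, when ladders of type `t` may only be followed by ladders with type in `next[t]`. -/
def nextColumns (next : List (List ℕ)) (q : ℕ × ℕ) : List (ℕ × ℕ) :=
  if q.2 = 0 then [(q.1, 1)] else (next.getD q.1 []).map fun t => (t, 0)

/-- The columns that may occur `d` steps after the column `q`. -/
def laterColumns (next : List (List ℕ)) (q : ℕ × ℕ) : ℕ → List (ℕ × ℕ)
  | 0 => [q]
  | d + 1 => (laterColumns next q d).flatMap (nextColumns next)

/-- Two columns, `d` steps apart along the cycle on level `0`, with sides `s` and `s'` of ladders
coloured by `w` and `w'`, obey the packing condition. -/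
def ColumnsCompatible (w : List ℕ) (s : ℕ) (w' : List ℕ) (s' d : ℕ) : Prop :=
  ∀ i < 6, ∀ i' < 6, i + i' + d ≤ 6 → ladderColor w i s = ladderColor w' i' s' →
    ladderColor w i s < i + i' + d

instance (w : List ℕ) (s : ℕ) (w' : List ℕ) (s' d : ℕ) :
    Decidable (ColumnsCompatible w s w' s' d) := by
  unfold ColumnsCompatible; infer_instance

/-- The ladder colourings `W`, one for each type, obey the packing condition around the cycle on
level `0` for columns at most `m` apart. -/
def CycleCompatible (next W : List (List ℕ)) (m : ℕ) : Prop :=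
  ∀ t < next.length, ∀ s < 2, ∀ d < m, ∀ q ∈ laterColumns next (t, s) (d + 1),
    ColumnsCompatible (W.getD t []) s (W.getD q.1 []) q.2 (d + 1)

instance (next W : List (List ℕ)) (m : ℕ) : Decidable (CycleCompatible next W m) := by
  unfold CycleCompatible; infer_instance

/-- `W` gives ladder colourings with `n` levels, one for each type, which fit together to packing
`k`-colourings. -/
structure IsScheme (k n m : ℕ) (next W : List (List ℕ)) : Prop where
  length_eq : W.length = next.length
  levels : ∀ w ∈ W, w.length = n
  ladder : ∀ w ∈ W, LadderColoring k w
  top : CycleCompatible next (W.map (List.take 6)) m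
  bottom : CycleCompatible next (W.map fun w => w.reverse.take 6) m

/-- `τ` is a valid choice of types for `r` ladders in a cyclic arrangement. -/
def IsTyping (r : ℕ) (next : List (List ℕ)) (τ : ℕ → ℕ) : Prop :=
  ∀ s < r, τ s < next.length ∧ τ ((s + 1) % r) ∈ next.getD (τ s) []

lemma getD_mem {α : Type*} {w : List α} {i : ℕ} (hi : i < w.length) (a : α) : w.getD i a ∈ w := by
  rw [List.getD_eq_getElem _ _ hi]
  exact List.getElem_mem hi

lemma LadderColoring.rung_ne {k : ℕ} {w : List ℕ} (h : LadderColoring k w) {a : ℕ} (ha : a ∈ w) :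
    (∀ s < 2, 1 ≤ rungColor a s ∧ rungColor a s ≤ k) ∧ a / 10 ≠ a % 10 := by
  induction w with
  | nil => simp at ha
  | cons b w ih =>
    rcases List.mem_cons.1 ha with rfl | ha
    · exact ⟨h.1, h.2.1⟩
    · exact ih h.2.2.2 ha

lemma LadderColoring.compatible {k : ℕ} {w : List ℕ} (h : LadderColoring k w) {i d : ℕ}
    (hd : d < 6) (hi : i + (d + 1) < w.length) :
    RungsCompatible (w.getD i 0) (w.getD (i + (d + 1)) 0) (d + 1) := by
  induction w generalizing i with
  | nil => simp at hi
  | cons b w ih =>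
    cases i with
    | zero =>
      have hdw : d < w.length := by simpa using hi
      have := h.2.2.1 d hd w[d] (by simp [hd, hdw])
      simpa [List.getD_eq_getElem?_getD, hdw, add_comm] using this
    | succ i =>
      have := ih h.2.2.2 (i := i) (by simp at hi; omega)
      rwa [show i + 1 + (d + 1) = i + (d + 1) + 1 by ring, List.getD_cons_succ,
        List.getD_cons_succ]

lemma rungColor_ne {a s t : ℕ} (ha : a / 10 ≠ a % 10) (hs : s < 2) (ht : t < 2) (hst : s ≠ t) :
    rungColor a s ≠ rungColor a t := by
  interval_cases s <;> interval_cases t <;> simp_all [rungColor, eq_comm]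

lemma LadderColoring.lt {k : ℕ} {w : List ℕ} (h : LadderColoring k w) (hk : k ≤ 6) {i i' s s' : ℕ}
    (hi : i < w.length) (hi' : i' < w.length) (hs : s < 2) (hs' : s' < 2)
    (hne : i ≠ i' ∨ s ≠ s') (hc : ladderColor w i s = ladderColor w i' s') :
    (ladderColor w i s : ℤ) < |(i : ℤ) - i'| + if s = s' then 0 else 1 := by
  wlog hii : i ≤ i' generalizing i i' s s'
  · rw [hc, abs_sub_comm]
    simpa only [eq_comm] using this hi' hi hs' hs (by tauto) hc.symm (by omega)
  rcases hii.eq_or_lt with rfl | hlt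
  · exact absurd hc (rungColor_ne (h.rung_ne (getD_mem hi 0)).2 hs hs' (by simpa using hne))
  obtain ⟨d, rfl⟩ : ∃ d, i' = i + (d + 1) := ⟨i' - i - 1, by omega⟩
  rw [abs_sub_comm, show ((i + (d + 1) : ℕ) : ℤ) - i = (d + 1 : ℕ) by push_cast; ring,
    abs_of_nonneg (by omega)]
  by_cases hd : d < 6
  · have := h.compatible hd hi' s hs s' hs' hc
    unfold ladderColor
    split_ifs at this ⊢ <;> push_cast <;> omega
  · have := ((h.rung_ne (getD_mem hi 0)).1 s hs).2
    unfold ladderColor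
    split_ifs <;> push_cast <;> omega

/-- The column type of a column of `genHgraph ℓ r`. -/
def columnType {r : ℕ} (τ : ℕ → ℕ) (j : ZMod (2 * r)) : ℕ × ℕ := (τ (j.val / 2), j.val % 2)

lemma columnType_add_one {r : ℕ} (hr : 2 ≤ r) {next : List (List ℕ)} {τ : ℕ → ℕ}
    (hτ : IsTyping r next τ) (j : ZMod (2 * r)) :
    columnType τ (j + 1) ∈ nextColumns next (columnType τ j) := by
  have : NeZero (2 * r) := ⟨by omega⟩
  have hj := j.val_lt
  have hv := two_mul_val_succ hr j
  unfold columnType nextColumns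
  rcases Nat.mod_two_eq_zero_or_one j.val with h0 | h1
  · rw [Nat.mod_eq_of_lt (by omega)] at hv
    simp [h0, hv, show (j.val + 1) / 2 = j.val / 2 by omega, Nat.add_mod]
  · rw [show j.val + 1 = 2 * (j.val / 2 + 1) by omega, Nat.mul_mod_mul_left] at hv
    have := (hτ (j.val / 2) (by omega)).2
    simpa [h1, hv] using this

lemma columnType_add {r : ℕ} (hr : 2 ≤ r) {next : List (List ℕ)} {τ : ℕ → ℕ}
    (hτ : IsTyping r next τ) (j : ZMod (2 * r)) (d : ℕ) :
    columnType τ (j + (d : ZMod (2 * r))) ∈ laterColumns next (columnType τ j) d := by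
  induction d with
  | zero => simp [laterColumns]
  | succ d ih =>
    rw [laterColumns, List.mem_flatMap]
    exact ⟨_, ih, by push_cast; rw [← add_assoc]; exact columnType_add_one hr hτ _⟩

lemma ladderColor_take {w : List ℕ} {i n s : ℕ} (hi : i < n) :
    ladderColor (w.take n) i s = ladderColor w i s := by
  simp [ladderColor, List.getD_eq_getElem?_getD, hi]

lemma ladderColor_reverse {w : List ℕ} {i s : ℕ} (hi : i < w.length) :
    ladderColor w.reverse i s = ladderColor w (w.length - 1 - i) s := by
  simp only [ladderColor, List.getD_eq_getElem?_getD, List.getElem?_reverse hi]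

/-- The colouring of `genHgraph ℓ r` given by ladder colourings `W` and ladder types `τ`. -/
def schemeColoring {ℓ r : ℕ} (W : List (List ℕ)) (τ : ℕ → ℕ)
    (u : Fin (ℓ + 2) × ZMod (2 * r)) : ℕ :=
  ladderColor (W.getD (columnType τ u.2).1 []) u.1 (columnType τ u.2).2

lemma CycleCompatible.lt {next W : List (List ℕ)} {m r : ℕ} (h : CycleCompatible next W m)
    (hr : 2 ≤ r) {τ : ℕ → ℕ} (hτ : IsTyping r next τ) (j : ZMod (2 * r)) {d i i' : ℕ}
    (hd : 0 < d) (hdm : d ≤ m) (hsum : i + i' + d ≤ 6)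
    (hc : ladderColor (W.getD (columnType τ j).1 []) i (columnType τ j).2 =
      ladderColor (W.getD (columnType τ (j + (d : ZMod (2 * r)))).1 []) i'
        (columnType τ (j + (d : ZMod (2 * r)))).2) :
    ladderColor (W.getD (columnType τ j).1 []) i (columnType τ j).2 < i + i' + d := by
  have : NeZero (2 * r) := ⟨by omega⟩
  obtain ⟨d, rfl⟩ : ∃ e, d = e + 1 := ⟨d - 1, by omega⟩
  have hj := j.val_lt
  exact h _ (hτ (j.val / 2) (by omega)).1 _ (Nat.mod_lt _ two_pos) d (by omega) _
    (columnType_add hr hτ j (d + 1)) i (by omega) i' (by omega) (by omega) hc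

theorem IsScheme.isPackingColoring {k ℓ m r : ℕ} {next W : List (List ℕ)} {τ : ℕ → ℕ}
    (h : IsScheme k (ℓ + 2) m next W) (hr : 2 ≤ r) (hτ : IsTyping r next τ) (hk : k ≤ 6)
    (hm : k ≤ m ∨ 2 * r = k ∧ k ≤ m + 1) :
    IsPackingColoring (genHgraph ℓ r) k (schemeColoring W τ) := by
  have : NeZero (2 * r) := ⟨by omega⟩
  have typ : ∀ j : ZMod (2 * r), (columnType τ j).1 < W.length := fun j => by
    have := j.val_lt
    exact h.length_eq ▸ (hτ (j.val / 2) (by omega)).1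
  have side : ∀ j : ZMod (2 * r), (columnType τ j).2 < 2 := fun j => Nat.mod_lt _ two_pos
  have mem : ∀ j : ZMod (2 * r), W.getD (columnType τ j).1 [] ∈ W := fun j => by
    exact getD_mem (typ j) []
  have hlen : ∀ j : ZMod (2 * r), (W.getD (columnType τ j).1 []).length = ℓ + 2 :=
    fun j => h.levels _ (mem j)
  have bound : ∀ v : Fin (ℓ + 2) × ZMod (2 * r),
      1 ≤ schemeColoring W τ v ∧ schemeColoring W τ v ≤ k := fun v =>
    ((h.ladder _ (mem v.2)).rung_ne (getD_mem (by rw [hlen]; exact v.1.isLt) 0)).1 _ (side _)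
  refine ⟨bound, fun u v huv hc p => ?_⟩
  by_contra! hp
  have hck := (bound u).2
  have same : ∀ {u v : Fin (ℓ + 2) × ZMod (2 * r)}, u ≠ v → SameLadder u v →
      schemeColoring W τ u = schemeColoring W τ v →
      (schemeColoring W τ u : ℤ) <
        |(u.1 : ℤ) - v.1| + if u.2.val % 2 = v.2.val % 2 then 0 else 1 := by
    intro u v huv hs hc
    have ht : (columnType τ u.2).1 = (columnType τ v.2).1 := congrArg τ hs
    unfold schemeColoring at hc ⊢
    rw [← ht] at hc
    refine (h.ladder _ (mem u.2)).lt hk (by rw [hlen]; exact u.1.isLt)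
      (by rw [hlen]; exact v.1.isLt) (side _) (side _) ?_ hc
    by_contra! hcon
    refine huv (Prod.ext (Fin.ext hcon.1) (ZMod.val_injective _ ?_))
    have h2 : u.2.val % 2 = v.2.val % 2 := hcon.2
    unfold SameLadder at hs
    omega
  -- the common treatment of the routes through the two cycles
  have cyc : ∀ (f : List ℕ → List ℕ) (g : ℕ → ℕ), CycleCompatible next (W.map f) m →
      (∀ j : ZMod (2 * r), ∀ i < ℓ + 2, g i < 6 → ∀ s,
        ladderColor (f (W.getD (columnType τ j).1 [])) (g i) s =
          ladderColor (W.getD (columnType τ j).1 []) i s) →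
      (∀ i < ℓ + 2, ∀ i' < ℓ + 2, |(i : ℤ) - i'| ≤ g i + g i') →
      ∀ (u v : Fin (ℓ + 2) × ZMod (2 * r)) (d : ℕ), u ≠ v →
        schemeColoring W τ u = schemeColoring W τ v → v.2 = u.2 + d →
        schemeColoring W τ u < g u.1 + g v.1 + d := by
    intro f g hf hfg hg u v d huv hc hd
    by_contra! hle
    have hck := (bound u).2
    have habs := hg u.1 u.1.isLt v.1 v.1.isLt
    have self : u.2 = v.2 → schemeColoring W τ u < g u.1 + g v.1 := fun h0 => by
      have := same huv (show SameLadder u v by rw [SameLadder, h0]) hc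
      rw [if_pos (by rw [h0])] at this
      omega
    rcases Nat.eq_zero_or_pos d with rfl | hd0
    · have := self (by simpa using hd.symm)
      omega
    · by_cases hdm : d ≤ m
      · have hmap : ∀ j : ZMod (2 * r), (W.map f).getD (columnType τ j).1 [] =
            f (W.getD (columnType τ j).1 []) := fun j => by
          rw [List.getD_eq_getElem _ _ (by rw [List.length_map]; exact typ j),
            List.getD_eq_getElem _ _ (typ j), List.getElem_map]
        have := hf.lt hr hτ u.2 (i := g u.1) (i' := g v.1) hd0 hdm (by omega) (by
          rw [← hd, hmap, hmap, hfg _ _ u.1.isLt (by omega), hfg _ _ v.1.isLt (by omega)]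
          exact hc)
        rw [hmap, hfg _ _ u.1.isLt (by omega)] at this
        exact absurd this (by simpa [schemeColoring] using hle)
      · have hdr : d = 2 * r := by omega
        have := self (by rw [hd, hdr, ZMod.natCast_self, add_zero])
        omega
  have cyc' : ∀ (f : List ℕ → List ℕ) (g : ℕ → ℕ), CycleCompatible next (W.map f) m →
      (∀ j : ZMod (2 * r), ∀ i < ℓ + 2, g i < 6 → ∀ s,
        ladderColor (f (W.getD (columnType τ j).1 [])) (g i) s =
          ladderColor (W.getD (columnType τ j).1 []) i s) →
      (∀ i < ℓ + 2, ∀ i' < ℓ + 2, |(i : ℤ) - i'| ≤ g i + g i') →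
      ∀ d : ℤ, v.2 = u.2 + d → (schemeColoring W τ u : ℤ) < g u.1 + g v.1 + |d| := by
    intro f g hf hfg hg d hd
    obtain ⟨e, rfl | rfl⟩ := d.eq_nat_or_neg
    · have := cyc f g hf hfg hg u v e huv hc (by simpa using hd)
      simp; omega
    · have := cyc f g hf hfg hg v u e huv.symm hc.symm (by rw [hd]; simp)
      simp; omega
  rcases near_of_walk hr p with ⟨hs, hle⟩ | ⟨d, hd, hle⟩ | ⟨d, hd, hle⟩
  · have := same huv hs hc
    omega
  · have := cyc' (List.take 6) id h.top (fun j i _ hi s => ladderColor_take hi)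
      (fun i _ i' _ => by simp only [id]; rw [abs_le]; omega) d hd
    simp only [id] at this
    omega
  · have := cyc' (fun w => w.reverse.take 6) (fun i => ℓ + 1 - i) h.bottom
      (fun j i hi hg s => by
        rw [ladderColor_take hg, ladderColor_reverse (by rw [hlen]; omega), hlen]
        congr 1; omega)
      (fun i _ i' _ => by rw [abs_le]; omega) d hd
    have h1 := u.1.isLt
    have h2 := v.1.isLt
    push_cast [show (u.1 : ℕ) ≤ ℓ + 1 by omega, show (v.1 : ℕ) ≤ ℓ + 1 by omega] at this
    omega

instance (k n m : ℕ) (next W : List (List ℕ)) : Decidable (IsScheme k n m next W) :=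
  decidable_of_iff (W.length = next.length ∧ (∀ w ∈ W, w.length = n) ∧
    (∀ w ∈ W, LadderColoring k w) ∧ CycleCompatible next (W.map (List.take 6)) m ∧
    CycleCompatible next (W.map fun w => w.reverse.take 6) m)
    ⟨fun ⟨h1, h2, h3, h4, h5⟩ => ⟨h1, h2, h3, h4, h5⟩,
      fun ⟨h1, h2, h3, h4, h5⟩ => ⟨h1, h2, h3, h4, h5⟩⟩

/-- Repeat `k` times the six rungs starting at level `p`. -/
def stretch (p k : ℕ) (w : List ℕ) : List ℕ :=
  w.take p ++ (fun x => (w.drop p).take 6 ++ x)^[k] (w.drop p)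

lemma LadderColoring.of_append {k : ℕ} {x y : List ℕ} (h : LadderColoring k (x ++ y)) :
    LadderColoring k y := by
  induction x with
  | nil => exact h
  | cons a x ih => exact ih h.2.2.2

lemma LadderColoring.append_congr {k : ℕ} {x y z : List ℕ} (h : LadderColoring k (x ++ y))
    (hyz : y.take 6 = z.take 6) (hz : LadderColoring k z) : LadderColoring k (x ++ z) := by
  induction x with
  | nil => exact hz
  | cons a x ih =>
    have : (x ++ y).take 6 = (x ++ z).take 6 := by
      simpa [List.take_append, List.take_take] using
        congrArg (fun l => x.take 6 ++ l.take (6 - x.length)) hyz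
    exact ⟨h.1, h.2.1, by simpa only [List.append_eq, this] using h.2.2.1, ih h.2.2.2⟩

lemma iterate_append_take {y : List ℕ} (hy : 6 ≤ y.length) (k : ℕ) :
    ((fun x => y.take 6 ++ x)^[k] y).take 6 = y.take 6 := by
  cases k with
  | zero => rfl
  | succ k => rw [Function.iterate_succ_apply', List.take_append_of_le_length (by simp [hy])]; simp

lemma exists_iterate_append_eq {α : Type*} (z y : List α) (k : ℕ) :
    ∃ x, x.length = k * z.length ∧ (fun x => z ++ x)^[k] y = x ++ y := by
  induction k with
  | zero => exact ⟨[], by simp⟩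
  | succ k ih =>
    obtain ⟨x, hx, h⟩ := ih
    exact ⟨z ++ x, by simp [hx]; ring, by rw [Function.iterate_succ_apply', h]; simp⟩

lemma LadderColoring.stretch {c p : ℕ} {w : List ℕ} (hw : p + 6 ≤ w.length)
    (h : LadderColoring c (stretch p 1 w)) (k : ℕ) : LadderColoring c (stretch p k w) := by
  have hy : 6 ≤ (w.drop p).length := by rw [List.length_drop]; omega
  have h1 : LadderColoring c ((w.drop p).take 6 ++ w.drop p) := h.of_append
  refine h.append_congr (by rw [iterate_append_take hy, iterate_append_take hy]) ?_
  induction k with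
  | zero => exact h1.of_append
  | succ k ih =>
    rw [Function.iterate_succ_apply']
    exact h1.append_congr (iterate_append_take hy k).symm ih

lemma take_stretch {p : ℕ} {w : List ℕ} (hw : p + 6 ≤ w.length) (k : ℕ) :
    (stretch p k w).take 6 = w.take 6 := by
  have hy : 6 ≤ (w.drop p).length := by rw [List.length_drop]; omega
  conv_rhs => rw [← List.take_append_drop p w]
  have := congrArg (List.take (6 - (w.take p).length)) (iterate_append_take hy k)
  rw [List.take_take, List.take_take, min_eq_left (Nat.sub_le ..)] at this
  rw [stretch, List.take_append, List.take_append, this]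

lemma take_reverse_stretch {p : ℕ} {w : List ℕ} (hw : p + 6 ≤ w.length) (k : ℕ) :
    (stretch p k w).reverse.take 6 = w.reverse.take 6 := by
  have hy : 6 ≤ (w.drop p).reverse.length := by rw [List.length_reverse, List.length_drop]; omega
  obtain ⟨x, -, hx⟩ := exists_iterate_append_eq ((w.drop p).take 6) (w.drop p) k
  conv_rhs => rw [← List.take_append_drop p w]
  rw [stretch, hx, List.reverse_append, List.reverse_append, List.reverse_append,
    List.append_assoc, List.take_append_of_le_length hy, List.take_append_of_le_length hy]

lemma length_stretch {p : ℕ} {w : List ℕ} (hw : p + 6 ≤ w.length) (k : ℕ) :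
    (stretch p k w).length = w.length + 6 * k := by
  obtain ⟨x, hl, hx⟩ := exists_iterate_append_eq ((w.drop p).take 6) (w.drop p) k
  rw [stretch, hx]
  simp at hl ⊢
  rw [hl, min_eq_left (by omega), min_eq_left (by omega)]
  omega

lemma IsScheme.stretch {k n m p : ℕ} {next W : List (List ℕ)} (h : IsScheme k n m next W)
    (hn : p + 6 ≤ n) (hW : ∀ w ∈ W, LadderColoring k (stretch p 1 w)) (j : ℕ) :
    IsScheme k (n + 6 * j) m next (W.map (_root_.stretch p j)) where
  length_eq := by rw [List.length_map, h.length_eq]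
  levels := by
    simp only [List.forall_mem_map]
    exact fun w hw => by rw [length_stretch (h.levels w hw ▸ hn), h.levels w hw]
  ladder := by
    simp only [List.forall_mem_map]
    exact fun w hw => (hW w hw).stretch (h.levels w hw ▸ hn) j
  top := by
    rw [List.map_map, List.map_congr_left (f := List.take 6 ∘ _) (g := List.take 6)
      fun w hw => take_stretch (h.levels w hw ▸ hn) j]
    exact h.top
  bottom := by
    rw [List.map_map, List.map_congr_left (g := fun w => w.reverse.take 6)
      fun w hw => take_reverse_stretch (h.levels w hw ▸ hn) j]
    exact h.bottom

lemma isTyping_even {r : ℕ} (hr : Even r) : IsTyping r [[1], [0]] fun s => s % 2 := by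
  intro s _
  dsimp only
  rw [Nat.mod_mod_of_dvd _ hr.two_dvd, Nat.add_mod]
  rcases Nat.mod_two_eq_zero_or_one s with h | h <;> simp [h]

lemma isTyping_odd_three {r : ℕ} (hr : Odd r) (hq : 3 ≤ r) :
    IsTyping r [[1], [0, 2], [3], [4], [0, 2]]
      fun s => if s + 3 < r then s % 2 else s + 5 - r := by
  intro s hs
  obtain ⟨t, rfl⟩ := hr
  have hmod : (s + 1) % (2 * t + 1) = if s = 2 * t then 0 else s + 1 := by
    split_ifs with h
    · rw [h, Nat.mod_self]
    · exact Nat.mod_eq_of_lt (by omega)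
  dsimp only
  rw [hmod]
  by_cases h : s + 3 < 2 * t + 1
  · have h0 : s ≠ 2 * t := by omega
    rcases Nat.mod_two_eq_zero_or_one s with h2 | h2
    · simp [h, h2, h0, Nat.add_mod, show s + 1 + 3 < 2 * t + 1 by omega]
    · simp only [if_pos h, if_neg h0, h2]
      split_ifs <;> simp <;> omega
  · rw [if_neg h]
    obtain ⟨e, he, hse⟩ : ∃ e < 3, 2 * t = s + e := ⟨2 * t - s, by omega, by omega⟩
    rw [hse]
    interval_cases e <;> grind

lemma isTyping_odd_five {r : ℕ} (hr : Odd r) (hq : 5 ≤ r) :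
    IsTyping r [[1], [0, 2], [3], [4], [5], [6], [0, 2]]
      fun s => if s + 5 < r then s % 2 else s + 7 - r := by
  intro s hs
  obtain ⟨t, rfl⟩ := hr
  have hmod : (s + 1) % (2 * t + 1) = if s = 2 * t then 0 else s + 1 := by
    split_ifs with h
    · rw [h, Nat.mod_self]
    · exact Nat.mod_eq_of_lt (by omega)
  dsimp only
  rw [hmod]
  by_cases h : s + 5 < 2 * t + 1
  · have h0 : s ≠ 2 * t := by omega
    rcases Nat.mod_two_eq_zero_or_one s with h2 | h2
    · simp [h, h2, h0, Nat.add_mod, show s + 1 + 5 < 2 * t + 1 by omega]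
    · simp only [if_pos h, if_neg h0, h2]
      split_ifs <;> simp <;> omega
  · rw [if_neg h]
    obtain ⟨e, he, hse⟩ : ∃ e < 5, 2 * t = s + e := ⟨2 * t - s, by omega, by omega⟩
    rw [hse]
    interval_cases e <;> grind

/-- Enough ladder colourings to packing `5`-colour all `genHgraph ℓ r` with `r` even. -/
lemma exists_isScheme_even {n : ℕ} (hn : 5 ≤ n) (h7 : n ≠ 7) :
    ∃ W, IsScheme 5 n 5 [[1], [0]] W := by
  have ext : ∀ (b : ℕ) (W : List (List ℕ)), IsScheme 5 b 5 [[1], [0]] W ∧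
      (∀ w ∈ W, LadderColoring 5 (stretch 0 1 w)) ∧ 6 ≤ b → b ≤ n → n % 6 = b % 6 →
      ∃ W, IsScheme 5 n 5 [[1], [0]] W := by
    intro b W h hbn hmod
    have := h.1.stretch (p := 0) (by omega) h.2.1 ((n - b) / 6)
    rw [show b + 6 * ((n - b) / 6) = n by omega] at this
    exact ⟨_, this⟩
  obtain rfl | rfl | rfl | h | h | h | h | h | h : n = 5 ∨ n = 6 ∨ n = 10 ∨
      8 ≤ n ∧ n % 6 = 2 ∨ 9 ≤ n ∧ n % 6 = 3 ∨ 11 ≤ n ∧ n % 6 = 5 ∨ 12 ≤ n ∧ n % 6 = 0 ∨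
      13 ≤ n ∧ n % 6 = 1 ∨ 16 ≤ n ∧ n % 6 = 4 := by omega
  · exact ⟨[[12, 41, 13, 51, 12], [13, 51, 12, 41, 13]], by decide +kernel⟩
  · exact ⟨[[12, 41, 13, 21, 15, 31], [13, 51, 12, 31, 14, 21]], by decide +kernel⟩
  · exact ⟨[[13, 51, 12, 41, 13, 21, 15, 31, 14, 21], [12, 41, 13, 51, 12, 31, 14, 21, 15, 31]],
      by decide +kernel⟩
  · exact ext 8 [[12, 41, 13, 21, 15, 31, 14, 21], [13, 51, 12, 31, 14, 21, 15, 31]]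
      (by decide +kernel) h.1 h.2
  · exact ext 9 [[12, 41, 13, 21, 15, 31, 12, 41, 13], [13, 51, 12, 31, 14, 21, 13, 51, 12]]
      (by decide +kernel) h.1 h.2
  · exact ext 11 [[12, 41, 13, 21, 15, 31, 12, 41, 13, 51, 12],
      [13, 51, 12, 31, 14, 21, 13, 51, 12, 41, 13]] (by decide +kernel) h.1 h.2
  · exact ext 12 [[12, 41, 13, 21, 15, 31, 12, 41, 13, 21, 15, 31],
      [13, 51, 12, 31, 14, 21, 13, 51, 12, 31, 14, 21]] (by decide +kernel) h.1 h.2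
  · exact ext 13 [[13, 51, 12, 31, 14, 21, 15, 31, 12, 41, 13, 51, 12],
      [12, 41, 13, 21, 15, 31, 14, 21, 13, 51, 12, 41, 13]] (by decide +kernel) h.1 h.2
  · exact ext 16 [[13, 51, 12, 31, 14, 21, 15, 31, 12, 41, 13, 51, 12, 31, 14, 21],
      [12, 41, 13, 21, 15, 31, 14, 21, 13, 51, 12, 41, 13, 21, 15, 31]]
      (by decide +kernel) h.1 h.2

/-- Enough ladder colourings to packing `6`-colour all `genHgraph ℓ r` with `r` odd and `ℓ ≥ 4`. -/
lemma exists_isScheme_odd {n : ℕ} (hn : 6 ≤ n) (h7 : n ≠ 7) :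
    ∃ W, IsScheme 6 n 6 [[1], [0, 2], [3], [4], [0, 2]] W := by
  have ext : ∀ (b : ℕ) (W : List (List ℕ)), IsScheme 6 b 6 [[1], [0, 2], [3], [4], [0, 2]] W ∧
      (∀ w ∈ W, LadderColoring 6 (stretch 2 1 w)) ∧ 8 ≤ b → b ≤ n → n % 6 = b % 6 →
      ∃ W, IsScheme 6 n 6 [[1], [0, 2], [3], [4], [0, 2]] W := by
    intro b W h hbn hmod
    have := h.1.stretch (p := 2) (by omega) h.2.1 ((n - b) / 6)
    rw [show b + 6 * ((n - b) / 6) = n by omega] at this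
    exact ⟨_, this⟩
  obtain rfl | rfl | rfl | rfl | h | h | h | h | h | h : n = 6 ∨ n = 8 ∨ n = 9 ∨ n = 11 ∨
      10 ≤ n ∧ n % 6 = 4 ∨
      12 ≤ n ∧ n % 6 = 0 ∨
      13 ≤ n ∧ n % 6 = 1 ∨
      14 ≤ n ∧ n % 6 = 2 ∨
      15 ≤ n ∧ n % 6 = 3 ∨
      17 ≤ n ∧ n % 6 = 5 := by omega
  · exact ⟨[[12, 41, 13, 21, 15, 31],
           [13, 51, 12, 31, 14, 21],
           [12, 41, 13, 21, 15, 31],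
           [15, 31, 12, 61, 13, 21],
           [13, 21, 16, 31, 12, 41]],
      by decide +kernel⟩
  · exact ⟨[[12, 41, 13, 21, 15, 31, 14, 21],
           [13, 51, 12, 31, 14, 21, 15, 31],
           [12, 41, 13, 21, 15, 31, 14, 21],
           [15, 31, 12, 41, 13, 21, 16, 31],
           [13, 21, 16, 31, 12, 41, 13, 51]],
      by decide +kernel⟩
  · exact ⟨[[13, 41, 12, 31, 16, 21, 13, 41, 12],
           [12, 51, 13, 61, 14, 31, 12, 51, 13],
           [14, 31, 12, 51, 16, 21, 13, 41, 12],
           [13, 21, 16, 51, 13, 41, 12, 31, 15],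
           [12, 51, 13, 21, 14, 31, 12, 61, 13]],
      by decide +kernel⟩
  · exact ⟨[[12, 51, 13, 21, 14, 31, 16, 21, 13, 41, 12],
           [13, 41, 12, 31, 15, 61, 14, 31, 12, 51, 13],
           [15, 21, 13, 41, 12, 31, 15, 21, 13, 41, 12],
           [12, 31, 14, 21, 15, 61, 13, 41, 12, 31, 15],
           [13, 61, 14, 21, 13, 51, 12, 41, 16, 21, 13]],
      by decide +kernel⟩
  · exact ext 10
      [[13, 51, 12, 41, 13, 21, 15, 31, 14, 21],
       [12, 41, 13, 51, 12, 31, 14, 21, 15, 31],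
       [15, 31, 12, 41, 13, 21, 15, 31, 14, 21],
       [13, 21, 14, 31, 12, 51, 13, 21, 16, 31],
       [12, 61, 13, 51, 12, 31, 14, 21, 13, 51]]
      (by decide +kernel) h.1 h.2
  · exact ext 12
      [[12, 41, 13, 21, 15, 31, 12, 41, 13, 21, 15, 31],
       [13, 51, 12, 31, 14, 21, 13, 51, 12, 31, 14, 21],
       [12, 41, 13, 21, 15, 31, 12, 41, 13, 21, 15, 31],
       [15, 31, 12, 41, 13, 21, 15, 31, 12, 61, 13, 21],
       [13, 61, 12, 31, 14, 21, 13, 51, 16, 31, 12, 41]]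
      (by decide +kernel) h.1 h.2
  · exact ext 13
      [[12, 41, 13, 51, 12, 31, 14, 21, 16, 51, 13, 41, 12],
       [13, 51, 12, 41, 13, 21, 15, 31, 16, 41, 12, 51, 13],
       [12, 41, 13, 51, 12, 31, 14, 21, 16, 51, 13, 41, 12],
       [15, 31, 12, 41, 13, 21, 15, 31, 14, 61, 12, 31, 15],
       [13, 61, 12, 31, 14, 21, 13, 51, 12, 41, 16, 21, 13]]
      (by decide +kernel) h.1 h.2
  · exact ext 14
      [[12, 41, 13, 21, 15, 31, 12, 41, 13, 21, 15, 31, 14, 21],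
       [13, 51, 12, 31, 14, 21, 13, 51, 12, 31, 14, 21, 15, 31],
       [12, 41, 13, 21, 15, 31, 12, 41, 13, 21, 15, 31, 14, 21],
       [15, 31, 12, 41, 13, 21, 15, 31, 12, 41, 13, 21, 16, 31],
       [13, 61, 12, 31, 14, 21, 13, 51, 12, 31, 14, 21, 13, 51]]
      (by decide +kernel) h.1 h.2
  · exact ext 15
      [[13, 51, 12, 31, 14, 21, 13, 51, 12, 31, 16, 21, 13, 41, 12],
       [12, 41, 13, 21, 15, 31, 12, 41, 13, 21, 16, 31, 12, 51, 13],
       [13, 51, 12, 31, 14, 21, 13, 51, 12, 31, 16, 21, 13, 41, 12],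
       [14, 21, 13, 51, 12, 31, 14, 21, 16, 51, 13, 41, 12, 31, 15],
       [12, 61, 13, 51, 12, 31, 14, 21, 13, 51, 12, 41, 16, 21, 13]]
      (by decide +kernel) h.1 h.2
  · exact ext 17
      [[13, 41, 12, 51, 13, 21, 14, 31, 15, 21, 13, 61, 12, 51, 13, 41, 12],
       [12, 51, 13, 41, 12, 31, 15, 21, 14, 31, 12, 61, 13, 41, 12, 51, 13],
       [13, 41, 12, 51, 13, 21, 14, 31, 15, 21, 13, 61, 12, 51, 13, 41, 12],
       [15, 21, 14, 31, 12, 51, 13, 21, 16, 31, 15, 21, 13, 41, 12, 31, 15],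
       [12, 61, 13, 41, 12, 31, 15, 21, 14, 31, 12, 51, 13, 41, 12, 61, 13]]
      (by decide +kernel) h.1 h.2

lemma exists_isPackingColoring_even {ℓ r : ℕ} (hℓ : 3 ≤ ℓ) (h5 : ℓ ≠ 5) (hr : 2 ≤ r)
    (he : Even r) : ∃ π, IsPackingColoring (genHgraph ℓ r) 5 π := by
  obtain ⟨W, hW⟩ := exists_isScheme_even (n := ℓ + 2) (by omega) (by omega)
  exact ⟨_, hW.isPackingColoring hr (isTyping_even he) (by omega) (Or.inl le_rfl)⟩

lemma exists_isPackingColoring_odd {ℓ r : ℕ} (hℓ : 3 ≤ ℓ) (h5 : ℓ ≠ 5) (hr : 2 ≤ r)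
    (ho : Odd r) : ∃ π, IsPackingColoring (genHgraph ℓ r) 6 π := by
  obtain ⟨t, rfl⟩ := id ho
  rcases hℓ.eq_or_lt with rfl | hℓ
  · obtain rfl | ht : t = 1 ∨ 2 ≤ t := by omega
    · have hW : IsScheme 6 5 5 [[1], [2], [0]]
          [[12, 31, 14, 21, 13],
           [61, 14, 23, 51, 12],
           [25, 31, 12, 41, 16]] := by
        decide +kernel
      exact ⟨_, hW.isPackingColoring (ℓ := 3) (τ := id) hr (by unfold IsTyping; decide) le_rfl
        (Or.inr ⟨rfl, le_rfl⟩)⟩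
    · have hW : IsScheme 6 5 6 [[1], [0, 2], [3], [4], [5], [6], [0, 2]]
          [[21, 15, 31, 14, 21],
           [31, 14, 21, 15, 31],
           [21, 15, 31, 14, 21],
           [31, 14, 21, 15, 32],
           [21, 15, 32, 41, 16],
           [31, 12, 41, 13, 21],
           [61, 14, 21, 13, 51]] := by
        decide +kernel
      exact ⟨_, hW.isPackingColoring (ℓ := 3) hr (isTyping_odd_five ho (by omega)) le_rfl
        (Or.inl le_rfl)⟩
  · obtain ⟨W, hW⟩ := exists_isScheme_odd (n := ℓ + 2) (by omega) (by omega)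
    exact ⟨_, hW.isPackingColoring hr (isTyping_odd_three ho (by omega)) le_rfl (Or.inl le_rfl)⟩

/-- The vertex of `genHgraph ℓ r` on level `v.1` and column `v.2`. -/
def gridVertex (ℓ r : ℕ) (v : ℕ × ℕ) : Fin (ℓ + 2) × ZMod (2 * r) := (Fin.ofNat _ v.1, v.2)

/-- The distance in the ladders hanging from the infinite path on level `0`. -/
def gridDist (u v : ℕ × ℕ) : ℕ :=
  (if u.2 / 2 = v.2 / 2 then Nat.dist u.1 v.1 else u.1 + v.1) + Nat.dist u.2 v.2

section walks

variable {ℓ r : ℕ}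

lemma adj_level_succ {i : ℕ} (hi : i ≤ ℓ) (j : ℕ) :
    (genHgraph ℓ r).Adj (gridVertex ℓ r (i, j)) (gridVertex ℓ r (i + 1, j)) := by
  rw [genHgraph, SimpleGraph.fromRel_adj]
  refine ⟨fun h => ?_, Or.inl (Or.inr (Or.inr (Or.inr ⟨Fin.ofNat _ i, j, ?_, rfl, ?_⟩)))⟩
  · have := congrArg (fun v => (v.1 : ℕ)) h
    simp only [gridVertex, Fin.val_ofNat, Nat.mod_eq_of_lt (show i < ℓ + 2 by omega),
      Nat.mod_eq_of_lt (show i + 1 < ℓ + 2 by omega)] at this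
    omega
  · rwa [Fin.val_ofNat, Nat.mod_eq_of_lt (by omega)]
  · exact Prod.ext (Fin.ext (by simp [gridVertex, Fin.val_add])) rfl

lemma natCast_ne_natCast_succ (hr : 2 ≤ r) (j : ℕ) :
    (j : ZMod (2 * r)) ≠ ((j + 1 : ℕ) : ZMod (2 * r)) := by
  have : Fact (1 < 2 * r) := ⟨by omega⟩
  push_cast
  simp

lemma adj_cycle (hr : 2 ≤ r) (j : ℕ) :
    (genHgraph ℓ r).Adj (gridVertex ℓ r (0, j)) (gridVertex ℓ r (0, j + 1)) := by
  rw [genHgraph, SimpleGraph.fromRel_adj]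
  refine ⟨fun h => natCast_ne_natCast_succ hr j (congrArg Prod.snd h),
    Or.inl (Or.inl ⟨j, rfl, ?_⟩)⟩
  simp [gridVertex]

lemma adj_rung (hr : 2 ≤ r) {i : ℕ} (hi : i ≤ ℓ) (s : ℕ) :
    (genHgraph ℓ r).Adj (gridVertex ℓ r (i, 2 * s)) (gridVertex ℓ r (i, 2 * s + 1)) := by
  rcases Nat.eq_zero_or_pos i with rfl | hi0
  · exact adj_cycle hr _
  have hv : (Fin.ofNat (ℓ + 2) i : ℕ) = i := by
    rw [Fin.val_ofNat, Nat.mod_eq_of_lt (by omega)]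
  have hs : ((2 * s : ℕ) : ZMod (2 * r)) = ((2 * (s % r) : ℕ) : ZMod (2 * r)) := by
    rw [ZMod.natCast_eq_natCast_iff', Nat.mul_mod_mul_left, Nat.mul_mod_mul_left, Nat.mod_mod]
  rw [genHgraph, SimpleGraph.fromRel_adj]
  refine ⟨fun h => natCast_ne_natCast_succ hr _ (congrArg Prod.snd h),
    Or.inl (Or.inr (Or.inr (Or.inl
      ⟨Fin.ofNat _ i, s % r, by omega, by omega, Nat.mod_lt _ (by omega), ?_, ?_⟩)))⟩
  · rw [gridVertex, hs]
  · rw [gridVertex, Nat.cast_succ, Nat.cast_succ, hs]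

lemma exists_walk_level_add (j i : ℕ) : ∀ d, i + d ≤ ℓ + 1 →
    ∃ p : (genHgraph ℓ r).Walk (gridVertex ℓ r (i, j)) (gridVertex ℓ r (i + d, j)), p.length = d
  | 0, _ => ⟨.nil, rfl⟩
  | d + 1, h => by
    obtain ⟨p, hp⟩ := exists_walk_level_add j i d (by omega)
    exact ⟨p.concat (adj_level_succ (i := i + d) (by omega) j), by simp [hp]⟩

lemma exists_walk_level (j : ℕ) {i i' : ℕ} (hi : i ≤ ℓ + 1) (hi' : i' ≤ ℓ + 1) :
    ∃ p : (genHgraph ℓ r).Walk (gridVertex ℓ r (i, j)) (gridVertex ℓ r (i', j)),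
      p.length = Nat.dist i i' := by
  rcases le_total i i' with h | h
  · obtain ⟨d, rfl⟩ := Nat.exists_eq_add_of_le h
    obtain ⟨p, hp⟩ := exists_walk_level_add (r := r) j i d hi'
    exact ⟨p, by rw [hp, Nat.dist]; omega⟩
  · obtain ⟨d, rfl⟩ := Nat.exists_eq_add_of_le h
    obtain ⟨p, hp⟩ := exists_walk_level_add (r := r) j i' d hi
    exact ⟨p.reverse, by rw [SimpleGraph.Walk.length_reverse, hp, Nat.dist]; omega⟩

lemma exists_walk_cycle_add (hr : 2 ≤ r) (j : ℕ) : ∀ d,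
    ∃ p : (genHgraph ℓ r).Walk (gridVertex ℓ r (0, j)) (gridVertex ℓ r (0, j + d)), p.length = d
  | 0 => ⟨.nil, rfl⟩
  | d + 1 => by
    obtain ⟨p, hp⟩ := exists_walk_cycle_add hr j d
    exact ⟨p.concat (adj_cycle hr (j + d)), by simp [hp]⟩

lemma exists_walk_of_le (hr : 2 ≤ r) {u v : ℕ × ℕ} (hu : u.1 ≤ ℓ) (hv : v.1 ≤ ℓ)
    (huv : u.2 ≤ v.2) :
    ∃ p : (genHgraph ℓ r).Walk (gridVertex ℓ r u) (gridVertex ℓ r v),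
      p.length = gridDist u v := by
  obtain ⟨i, j⟩ := u
  obtain ⟨i', j'⟩ := v
  obtain ⟨d, rfl⟩ := Nat.exists_eq_add_of_le huv
  dsimp only at hu hv
  unfold gridDist
  split_ifs with hs <;> dsimp only at hs ⊢
  · obtain ⟨p, hp⟩ :=
      exists_walk_level (ℓ := ℓ) (r := r) j (i := i) (i' := i') (by omega) (by omega)
    obtain rfl | ⟨rfl, s, rfl⟩ : d = 0 ∨ d = 1 ∧ ∃ s, j = 2 * s := by
      by_cases h : d = 0
      · exact Or.inl h
      · exact Or.inr ⟨by omega, j / 2, by omega⟩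
    · exact ⟨p, by rw [hp, add_zero, Nat.dist_self, add_zero]⟩
    · refine ⟨p.concat (adj_rung hr hv _), ?_⟩
      rw [SimpleGraph.Walk.length_concat, hp, Nat.dist, Nat.dist]
      omega
  · obtain ⟨p, hp⟩ := exists_walk_level (ℓ := ℓ) (r := r) j (i := i) (i' := 0) (by omega) (by omega)
    obtain ⟨q, hq⟩ := exists_walk_cycle_add (ℓ := ℓ) hr j d
    obtain ⟨p', hp'⟩ :=
      exists_walk_level (ℓ := ℓ) (r := r) (j + d) (i := 0) (i' := i') (by omega) (by omega)
    refine ⟨(p.append q).append p', ?_⟩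
    rw [SimpleGraph.Walk.length_append, SimpleGraph.Walk.length_append, hp, hq, hp']
    simp only [Nat.dist]
    omega

lemma gridDist_comm (u v : ℕ × ℕ) : gridDist u v = gridDist v u := by
  simp only [gridDist, Nat.dist_comm u.1, Nat.dist_comm u.2, add_comm u.1, eq_comm (a := u.2 / 2)]

lemma exists_walk_gridDist (hr : 2 ≤ r) {u v : ℕ × ℕ} (hu : u.1 ≤ ℓ) (hv : v.1 ≤ ℓ) :
    ∃ p : (genHgraph ℓ r).Walk (gridVertex ℓ r u) (gridVertex ℓ r v),
      p.length = gridDist u v := by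
  rcases le_total u.2 v.2 with h | h
  · exact exists_walk_of_le hr hu hv h
  · obtain ⟨p, hp⟩ := exists_walk_of_le (ℓ := ℓ) hr hv hu h
    exact ⟨p.reverse, by rw [SimpleGraph.Walk.length_reverse, hp, gridDist_comm]⟩

lemma gridVertex_injective {u v : ℕ × ℕ} (hu : u.1 ≤ ℓ) (hv : v.1 ≤ ℓ)
    (hd : Nat.dist u.2 v.2 < 2 * r) (h : gridVertex ℓ r u = gridVertex ℓ r v) : u = v := by
  refine Prod.ext ?_ ?_
  · have := congrArg (fun w => (w.1 : ℕ)) h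
    simpa [gridVertex, Nat.mod_eq_of_lt (show u.1 < ℓ + 2 by omega),
      Nat.mod_eq_of_lt (show v.1 < ℓ + 2 by omega)] using this
  · have := (ZMod.natCast_eq_natCast_iff _ _ _).1 (congrArg Prod.snd h)
    refine this.eq_of_abs_lt ?_
    rw [Nat.dist] at hd
    rw [abs_lt]
    omega

lemma IsPackingColoring.lt_gridDist {k : ℕ} {π : Fin (ℓ + 2) × ZMod (2 * r) → ℕ}
    (h : IsPackingColoring (genHgraph ℓ r) k π) (hr : 2 ≤ r) {u v : ℕ × ℕ}
    (hu : u.1 ≤ ℓ) (hv : v.1 ≤ ℓ) (hd : Nat.dist u.2 v.2 < 2 * r) (huv : u ≠ v)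
    (hc : π (gridVertex ℓ r u) = π (gridVertex ℓ r v)) :
    π (gridVertex ℓ r u) < gridDist u v := by
  obtain ⟨p, hp⟩ := exists_walk_gridDist (ℓ := ℓ) hr hu hv
  exact hp ▸ h.2 _ _ (fun e => huv (gridVertex_injective hu hv hd e)) hc p

end walks

/-- Giving colour `c` to the vertex `v` violates the packing condition with `a.1` coloured `a.2`. -/
def conflict (v : ℕ × ℕ) (c : ℕ) (a : (ℕ × ℕ) × ℕ) : Bool :=
  v != a.1 && c == a.2 && Nat.ble (gridDist v a.1) c

/-- A backtracking search which succeeds when the partial colouring `asg` does not extend to the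
vertices in the list with colours from their lists. -/
def refutes : List ((ℕ × ℕ) × List ℕ) → List ((ℕ × ℕ) × ℕ) → Bool
  | [], _ => false
  | (v, cs) :: L, asg => cs.all fun c => asg.any (conflict v c) || refutes L ((v, c) :: asg)

lemma not_refutes {P : ℕ × ℕ → Prop} {c : ℕ × ℕ → ℕ}
    (hc : ∀ u v, P u → P v → u ≠ v → c u = c v → c u < gridDist u v)
    {L : List ((ℕ × ℕ) × List ℕ)} {asg : List ((ℕ × ℕ) × ℕ)}
    (hL : ∀ e ∈ L, P e.1 ∧ c e.1 ∈ e.2) (hasg : ∀ a ∈ asg, P a.1 ∧ c a.1 = a.2) :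
    refutes L asg = false := by
  induction L generalizing asg with
  | nil => rfl
  | cons e L ih =>
    obtain ⟨v, cs⟩ := e
    obtain ⟨hv, hcs⟩ := hL _ List.mem_cons_self
    rw [refutes, List.all_eq_false]
    refine ⟨c v, hcs, ?_⟩
    rw [Bool.not_eq_true, Bool.or_eq_false_iff]
    refine ⟨?_, ih (fun e he => hL e (List.mem_cons_of_mem _ he)) ?_⟩
    · rw [List.any_eq_false]
      intro a ha hcon
      simp only [conflict, Bool.and_eq_true, bne_iff_ne, beq_iff_eq, Nat.ble_eq] at hcon
      obtain ⟨hPa, hca⟩ := hasg a ha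
      exact (hc v a.1 hv hPa hcon.1.1 (hcon.1.2.trans hca.symm)).not_ge hcon.2
    · exact List.forall_mem_cons.2 ⟨⟨hv, rfl⟩, hasg⟩

lemma mem_range'_of_bounds {a n : ℕ} (h : 1 ≤ a ∧ a ≤ n) : a ∈ List.range' 1 n := by
  rw [List.mem_range'_1]
  omega

lemma not_isPackingColoring_four {ℓ r : ℕ} (hℓ : 2 ≤ ℓ) (hr : 2 ≤ r)
    (π : Fin (ℓ + 2) × ZMod (2 * r) → ℕ) : ¬ IsPackingColoring (genHgraph ℓ r) 4 π := by
  intro h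
  have key := not_refutes (P := fun v => v.1 ≤ 2 ∧ v.2 < 4) (c := fun v => π (gridVertex ℓ r v))
    (fun u v hu hv huv hc => h.lt_gridDist hr (by omega) (by omega)
      (by rw [Nat.dist]; omega) huv hc)
    (L := [(1, 1), (1, 0), (0, 1), (0, 0), (2, 1), (2, 0), (0, 2), (1, 2), (0, 3), (1, 3), (2, 2),
      (2, 3)].map fun v => (v, List.range' 1 4)) (asg := [])
    (by
      rw [List.forall_mem_map]
      exact fun v hv => ⟨by revert v; decide, mem_range'_of_bounds (h.1 _)⟩) (by simp)
  revert key
  decide +kernel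

/-- A packing `5`-colouring of the top four levels of the ladders hanging from the infinite path
on level `0`. -/
def IsGridColoring (c : ℕ × ℕ → ℕ) : Prop :=
  (∀ v, 1 ≤ c v ∧ c v ≤ 5) ∧
    ∀ u v, u.1 ≤ 3 → v.1 ≤ 3 → u ≠ v → c u = c v → c u < gridDist u v

lemma IsPackingColoring.isGridColoring {ℓ r : ℕ} {π : Fin (ℓ + 2) × ZMod (2 * r) → ℕ}
    (h : IsPackingColoring (genHgraph ℓ r) 5 π) (hℓ : 3 ≤ ℓ) (hr : 3 ≤ r) :
    IsGridColoring fun v => π (gridVertex ℓ r v) := by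
  refine ⟨fun v => h.1 _, fun u v hu hv huv hc => ?_⟩
  by_cases hd : Nat.dist u.2 v.2 < 2 * r
  · exact h.lt_gridDist (by omega) (by omega) (by omega) hd huv hc
  · have := (h.1 (gridVertex ℓ r u)).2
    unfold gridDist
    dsimp only
    omega

namespace IsGridColoring

variable {c : ℕ × ℕ → ℕ}

lemma shift (h : IsGridColoring c) (s : ℕ) : IsGridColoring fun v => c (v.1, v.2 + 2 * s) := by
  refine ⟨fun v => h.1 _, fun u v hu hv huv hc => ?_⟩
  have := h.2 (u.1, u.2 + 2 * s) (v.1, v.2 + 2 * s) hu hv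
    (fun e => huv (by simp only [Prod.mk.injEq] at e; exact Prod.ext e.1 (by omega))) hc
  simpa [gridDist, Nat.dist_add_add_right, Nat.add_mul_div_left] using this

lemma refutes_eq_false (h : IsGridColoring c) {L : List ((ℕ × ℕ) × List ℕ)}
    (hL : ∀ e ∈ L, c e.1 ∈ e.2) (hLl : ∀ e ∈ L, e.1.1 ≤ 3)
    {vs : List (ℕ × ℕ)} (hvs : ∀ v ∈ vs, v.1 ≤ 3) :
    refutes (L ++ vs.map fun v => (v, List.range' 1 5)) [] = false := by
  refine not_refutes (P := fun v => v.1 ≤ 3) (fun u v hu hv => h.2 u v hu hv) ?_ (by simp)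
  rw [List.forall_mem_append, List.forall_mem_map]
  exact ⟨fun e he => ⟨hLl e he, hL e he⟩, fun v hv => ⟨hvs v hv, mem_range'_of_bounds (h.1 _)⟩⟩

lemma exists_one (h : IsGridColoring c) (s : ℕ) :
    c (0, 2 * (s + 1)) = 1 ∨ c (0, 2 * (s + 1) + 1) = 1 := by
  by_contra! hne
  have h2 := h.1 (0, 2 * (s + 1))
  have h3 := h.1 (0, 2 * (s + 1) + 1)
  have key := (h.shift s).refutes_eq_false
    (L := [((0, 3), [2, 3, 4, 5]), ((0, 2), [2, 3, 4, 5])])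
    (vs := [(1, 2), (1, 3), (2, 2), (2, 3), (0, 1), (1, 1), (0, 0), (0, 4), (0, 5), (1, 4), (3, 3),
      (3, 2), (1, 0), (2, 1), (2, 4), (1, 5)])
    (by
      rw [List.forall_mem_cons, List.forall_mem_singleton]
      dsimp only
      rw [show 3 + 2 * s = 2 * (s + 1) + 1 by ring, show 2 + 2 * s = 2 * (s + 1) by ring]
      simp only [List.mem_cons, List.not_mem_nil]
      omega)
    (by decide) (by decide)
  revert key
  decide +kernel

lemma one_succ_ne (h : IsGridColoring c) {j : ℕ} (hj : c (0, j) = 1) : c (0, j + 1) ≠ 1 := by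
  intro hj'
  have := h.2 (0, j) (0, j + 1) (by simp) (by simp) (by simp) (hj.trans hj'.symm)
  rw [hj] at this
  simp [gridDist, Nat.dist] at this

lemma exists_forall_eq_one (h : IsGridColoring c) :
    ∃ N, ∃ o < 2, ∀ s ≥ N, c (0, 2 * s + o) = 1 := by
  by_cases hs : ∃ s ≥ 1, c (0, 2 * s + 1) = 1
  · obtain ⟨N, hN, h1⟩ := hs
    refine ⟨N, 1, by simp, fun s hs => ?_⟩
    induction s, hs using Nat.le_induction with
    | base => exact h1
    | succ s hs ih => exact (h.exists_one s).resolve_left (h.one_succ_ne ih)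
  · push Not at hs
    refine ⟨1, 0, by simp, fun s hs1 => ?_⟩
    obtain ⟨t, rfl⟩ := Nat.exists_eq_add_of_le' hs1
    exact (h.exists_one t).resolve_right (hs _ hs1)

lemma two_alternates (h : IsGridColoring c) {N o : ℕ} (ho : o < 2)
    (h1 : ∀ s ≥ N, c (0, 2 * s + o) = 1) {s : ℕ} (hs : N + 2 ≤ s) :
    c (0, 2 * (s + 1) + (1 - o)) = 2 ↔ ¬ c (0, 2 * s + (1 - o)) = 2 := by
  obtain ⟨t, rfl⟩ := Nat.exists_eq_add_of_le' (show 2 ≤ s by omega)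
  have ne_one : ∀ s ≥ N, c (0, 2 * s + (1 - o)) ≠ 1 := fun s hs hcon => by
    have := h.2 (0, 2 * s + o) (0, 2 * s + (1 - o)) (by simp) (by simp) (by simp; omega)
      ((h1 s hs).trans hcon.symm)
    rw [h1 s hs] at this
    simp only [gridDist, Nat.dist] at this
    split_ifs at this <;> omega
  constructor
  · intro h2 h2'
    have := h.2 (0, 2 * (t + 2) + (1 - o)) (0, 2 * (t + 2 + 1) + (1 - o)) (by simp) (by simp)
      (by simp) (h2'.trans h2.symm)
    rw [h2'] at this
    simp only [gridDist, Nat.dist] at this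
    split_ifs at this <;> omega
  · intro h2'
    by_contra h2
    have hb := h.1 (0, 2 * (t + 2) + (1 - o))
    have hb' := h.1 (0, 2 * (t + 2 + 1) + (1 - o))
    have hn := ne_one (t + 2) (by omega)
    have hn' := ne_one (t + 2 + 1) (by omega)
    have key := fun vs => (h.shift t).refutes_eq_false (vs := vs)
      (L := ((List.range 6).map fun k => ((0, 2 * k + o), [1])) ++
        [((0, 5 - o), [3, 4, 5]), ((0, 7 - o), [3, 4, 5])])
      (by
        rw [List.forall_mem_append, List.forall_mem_map, List.forall_mem_cons,
          List.forall_mem_singleton]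
        dsimp only
        rw [show 5 - o + 2 * t = 2 * (t + 2) + (1 - o) by omega,
          show 7 - o + 2 * t = 2 * (t + 2 + 1) + (1 - o) by omega]
        simp only [List.mem_cons, List.not_mem_nil]
        refine ⟨fun k _ => ?_, by omega, by omega⟩
        rw [show 2 * k + o + 2 * t = 2 * (t + k) + o by ring, h1 _ (by omega)]
        simp)
      (by rw [List.forall_mem_append, List.forall_mem_map]; simp)
    interval_cases o
    · have := key [(1, 6), (0, 3), (2, 6), (2, 7), (1, 7), (3, 6), (1, 4), (1, 5), (2, 5), (2, 4),
        (1, 8), (0, 9), (1, 3), (1, 2), (0, 1), (2, 3), (2, 9), (2, 8), (0, 11), (1, 10), (1, 9),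
        (3, 8)] (by decide)
      revert this
      decide +kernel
    · have := key [(1, 5), (1, 4), (2, 4), (2, 5), (3, 5), (1, 7), (0, 8), (1, 6), (2, 6), (0, 2),
        (1, 3), (2, 7), (1, 8), (0, 10), (1, 9), (2, 8), (0, 0), (1, 1), (1, 2), (2, 2), (3, 3),
        (2, 3)] (by decide)
      revert this
      decide +kernel

end IsGridColoring

lemma not_isPackingColoring_five {ℓ r : ℕ} (hℓ : 3 ≤ ℓ) (hr : 3 ≤ r) (hodd : Odd r)
    (π : Fin (ℓ + 2) × ZMod (2 * r) → ℕ) : ¬ IsPackingColoring (genHgraph ℓ r) 5 π := by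
  intro hπ
  have h := hπ.isGridColoring hℓ hr
  obtain ⟨N, o, ho, h1⟩ := h.exists_forall_eq_one
  have iter : ∀ t, π (gridVertex ℓ r (0, 2 * (N + 2 + t) + (1 - o))) = 2 ↔
      (Even t ↔ π (gridVertex ℓ r (0, 2 * (N + 2) + (1 - o))) = 2) := by
    intro t
    induction t with
    | zero => simp
    | succ t ih =>
      rw [← add_assoc, h.two_alternates ho h1 (by omega), ih, Nat.even_add_one]
      tauto
  have period : gridVertex ℓ r (0, 2 * (N + 2 + r) + (1 - o)) =
      gridVertex ℓ r (0, 2 * (N + 2) + (1 - o)) := by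
    have := ZMod.natCast_self (2 * r)
    simp only [gridVertex, Prod.mk.injEq, true_and]
    push_cast at this ⊢
    linear_combination this
  have := iter r
  rw [period] at this
  have := Nat.not_even_iff_odd.2 hodd
  tauto

lemma IsPackingColoring.mono {V : Type*} {G : SimpleGraph V} {k k' : ℕ} {π : V → ℕ}
    (h : IsPackingColoring G k π) (hk : k ≤ k') : IsPackingColoring G k' π :=
  ⟨fun v => ⟨(h.1 v).1, (h.1 v).2.trans hk⟩, h.2⟩

lemma packingChromaticNumber_eq_succ {V : Type*} {G : SimpleGraph V} {k : ℕ}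
    (h : ∃ π, IsPackingColoring G (k + 1) π) (h' : ∀ π, ¬ IsPackingColoring G k π) :
    packingChromaticNumber G = k + 1 := by
  refine le_antisymm (Nat.sInf_le h) (le_csInf ⟨_, h⟩ ?_)
  rintro k' ⟨π, hπ⟩
  by_contra! hlt
  exact h' π (hπ.mono (by omega))

theorem packingChromaticNumber_genHgraph (ℓ r : ℕ) (hℓ : 3 ≤ ℓ) (hℓ5 : ℓ ≠ 5) (hr : 2 ≤ r) :
    packingChromaticNumber (genHgraph ℓ r) = if Even r then 5 else 6 := by
  split_ifs with he
  · exact packingChromaticNumber_eq_succ (exists_isPackingColoring_even hℓ hℓ5 hr he)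
      (not_isPackingColoring_four (by omega) hr)
  · have ho := Nat.not_even_iff_odd.1 he
    obtain ⟨t, ht⟩ := id ho
    exact packingChromaticNumber_eq_succ (exists_isPackingColoring_odd hℓ hℓ5 hr ho)
      (not_isPackingColoring_five hℓ (by omega) ho)
end
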